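/- arXiv:1610.02704 — 2 statements merged into one kernel-verified Lean document; each statement's English description precedes it below -/
import Mathlib

section
/- There exists a constant α₂ ≥ 1 such that the following holds. Let q = 2^b and let u, v be densities on [q]^n with H∞(u) + H∞(v) ≥ 2b(n − t). Then for all b ≥ α₂·log₂ n and all integers d ≥ α₂·t, the function Acc_{u,v} : {-1,1}^n → ℝ≥0 is a (2^{-0.5b}, 2^{-0.5bd})-approximate conical d-junta. -/
open scoped BigOperators

noncomputable section

/-- Sign of a Boolean bit, encoding `b ↦ (-1)^b ∈ {-1,1}`. -/
def sgn (x : Bool) : ℝ := if x then -1 else 1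

/-- Expectation under the uniform distribution on a finite type. -/
def uexp {Ω : Type*} [Fintype Ω] (f : Ω → ℝ) : ℝ :=
  (∑ x, f x) / (Fintype.card Ω : ℝ)

/-- The parity character `χ_S(x) = ∏_{i ∈ S} x_i` on the cube `{-1,1}^n`. -/
def chi {n : ℕ} (S : Finset (Fin n)) (x : Fin n → Bool) : ℝ :=
  ∏ i ∈ S, sgn (x i)

/-- Fourier coefficient `f̂(S) = E[f · χ_S]`. -/
def fCoeff {n : ℕ} (f : (Fin n → Bool) → ℝ) (S : Finset (Fin n)) : ℝ :=
  uexp (fun x => f x * chi S x)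

open Classical in
/-- Fourier degree: the largest `|S|` with `f̂(S) ≠ 0`. -/
def fdeg {n : ℕ} (f : (Fin n → Bool) → ℝ) : ℕ :=
  (Finset.univ.filter (fun S : Finset (Fin n) => fCoeff f S ≠ 0)).sup Finset.card

/-- A `d`-junta: a function depending on at most `d` coordinates. -/
def IsJunta {n : ℕ} (d : ℕ) (h : (Fin n → Bool) → ℝ) : Prop :=
  ∃ T : Finset (Fin n), T.card ≤ d ∧ ∀ x y, (∀ i ∈ T, x i = y i) → h x = h y

/-- A conical `d`-junta: a nonnegative combination of nonnegative `d`-juntas. -/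
def IsConicalJunta {n : ℕ} (d : ℕ) (f : (Fin n → Bool) → ℝ) : Prop :=
  ∃ (N : ℕ) (c : Fin N → ℝ) (g : Fin N → (Fin n → Bool) → ℝ),
    (∀ i, 0 ≤ c i) ∧ (∀ i x, 0 ≤ g i x) ∧ (∀ i, IsJunta d (g i)) ∧
    ∀ x, f x = ∑ i, c i * g i x

/-- Nonnegative degree `deg₊(f)`: least `d` such that `f` is a conical `d`-junta. -/
def degPlus {n : ℕ} (f : (Fin n → Bool) → ℝ) : ℕ :=
  sInf {d | IsConicalJunta d f}

/-- The (modified inner-product) gadget `g : {0,1}^b × {0,1}^b → {-1,1}`,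
with output encoded as a Boolean exponent: `g(x,y) = x₁ ⊕ y₁ ⊕ (⊕ᵢ xᵢyᵢ)`. -/
def gadget {b : ℕ} (x y : Fin b → Bool) : Bool :=
  decide (((∑ i : Fin b,
        (if x i then (1 : ZMod 2) else 0) * (if y i then (1 : ZMod 2) else 0))
    + (if h : 0 < b then
        (if x ⟨0, h⟩ then (1 : ZMod 2) else 0) + (if y ⟨0, h⟩ then (1 : ZMod 2) else 0)
      else 0)) = 1)

/-- `G = g^{⊗n}`, the gadget applied coordinatewise. -/
def gadgetN {n b : ℕ} (x y : Fin n → Fin b → Bool) : Fin n → Bool :=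
  fun i => gadget (x i) (y i)

/-- The pattern matrix `M_f^b(x,y) = f(g^{⊗n}(x,y))`. -/
def patternMatrix {n : ℕ} (b : ℕ) (f : (Fin n → Bool) → ℝ) :
    (Fin n → Fin b → Bool) → (Fin n → Fin b → Bool) → ℝ :=
  fun x y => f (gadgetN x y)

/-- Nonnegative rank: least `r` such that `M` is a sum of `r` nonnegative rank-1 matrices. -/
def nnRank {α β : Type*} [Fintype α] [Fintype β] (M : α → β → ℝ) : ℕ :=
  sInf {r | ∃ (u : Fin r → α → ℝ) (v : Fin r → β → ℝ),
    (∀ i a, 0 ≤ u i a) ∧ (∀ i b, 0 ≤ v i b) ∧ ∀ a b, M a b = ∑ i, u i a * v i b}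

/-- Entrywise sup-norm of a matrix. -/
def supAbs {α β : Type*} [Fintype α] [Fintype β] (M : α → β → ℝ) : ℝ :=
  ⨆ p : α × β, |M p.1 p.2|

/-- `ε`-approximate nonnegative rank. -/
def approxNNRank {α β : Type*} [Fintype α] [Fintype β] (ε : ℝ) (M : α → β → ℝ) : ℕ :=
  sInf {r | ∃ M' : α → β → ℝ, (∀ a b, 0 ≤ M' a b) ∧
    (∀ a b, |M' a b - M a b| ≤ ε * supAbs M) ∧ nnRank M' ≤ r}

/-- A density: nonnegative with expectation 1 under the uniform distribution. -/
def IsDensity {Ω : Type*} [Fintype Ω] (u : Ω → ℝ) : Prop :=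
  (∀ x, 0 ≤ u x) ∧ uexp u = 1

/-- `Pr_{X ~ μ}[X ∈ S]` for a density `μ`. -/
def prSet {Ω : Type*} [Fintype Ω] (μ : Ω → ℝ) (S : Finset Ω) : ℝ :=
  (∑ x ∈ S, μ x) / (Fintype.card Ω : ℝ)

/-- Min-entropy `H∞(u) = min_x log₂(|Ω| / u(x)) = -log₂ max_x Pr[X = x]`. -/
def minEntropy {Ω : Type*} [Fintype Ω] (u : Ω → ℝ) : ℝ :=
  - Real.logb 2 (⨆ x, u x / (Fintype.card Ω : ℝ))

open Classical in
/-- `Pr_{X ~ u}[X_I = y_I]`, the probability that the projection to `I` agrees with `y`. -/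
def prMarg {n : ℕ} {α : Type*} [Fintype α] (u : (Fin n → α) → ℝ) (I : Finset (Fin n))
    (y : Fin n → α) : ℝ :=
  (∑ x ∈ Finset.univ.filter (fun x : Fin n → α => ∀ i ∈ I, x i = y i), u x)
    / (Fintype.card (Fin n → α) : ℝ)

/-- Min-entropy of the projection `X_I` for `X ~ u`. -/
def projMinEntropy {n : ℕ} {α : Type*} [Fintype α] (u : (Fin n → α) → ℝ)
    (I : Finset (Fin n)) : ℝ :=
  - Real.logb 2 (⨆ y : Fin n → α, prMarg u I y)

/-- Blockwise-dense: every projection has min-entropy at least `0.8 |I| log₂ q`. -/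
def IsBlockwiseDense {n : ℕ} {α : Type*} [Fintype α] (u : (Fin n → α) → ℝ) : Prop :=
  ∀ I : Finset (Fin n),
    0.8 * (I.card : ℝ) * Real.logb 2 (Fintype.card α) ≤ projMinEntropy u I

/-- `d`-CBD with fixed set `I`: `X_I` is fixed and every disjoint projection is dense. -/
def IsCBDWith {n : ℕ} {α : Type*} [Fintype α] (d : ℝ) (I : Finset (Fin n))
    (u : (Fin n → α) → ℝ) : Prop :=
  (I.card : ℝ) ≤ d ∧ projMinEntropy u I = 0 ∧
  ∀ J : Finset (Fin n), Disjoint J I →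
    0.8 * (J.card : ℝ) * Real.logb 2 (Fintype.card α) ≤ projMinEntropy u J

/-- `d`-CBD distribution. -/
def IsCBD {n : ℕ} {α : Type*} [Fintype α] (d : ℝ) (u : (Fin n → α) → ℝ) : Prop :=
  ∃ I, IsCBDWith d I u

open Classical in
/-- `Acc_{u,v}`: the density on `{-1,1}^n` of `g^{⊗n}(X,Y)` for independent `X ~ u`, `Y ~ v`. -/
def AccFn {n b : ℕ} (u v : (Fin n → Fin b → Bool) → ℝ) (z : Fin n → Bool) : ℝ :=
  (2 : ℝ) ^ n * (∑ x : Fin n → Fin b → Bool, ∑ y : Fin n → Fin b → Bool,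
      if gadgetN x y = z then u x * v y else 0)
    / (Fintype.card (Fin n → Fin b → Bool) : ℝ) ^ 2

/-- `ε`-decaying function: mean zero with `|ĥ(S)| ≤ ε^{|S|}`. -/
def IsDecaying {n : ℕ} (ε : ℝ) (h : (Fin n → Bool) → ℝ) : Prop :=
  uexp h = 0 ∧ ∀ S : Finset (Fin n), |fCoeff h S| ≤ ε ^ S.card

/-- A `d`-conjunction, normalized to have expectation 1. -/
def IsConjunction {n : ℕ} (d : ℕ) (C : (Fin n → Bool) → ℝ) : Prop :=
  ∃ (I : Finset (Fin n)) (a : Fin n → Bool), I.card ≤ d ∧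
    ∀ x, C x = 2 ^ I.card * (if ∀ i ∈ I, x i = a i then (1 : ℝ) else 0)

/-- `(ε,δ)`-approximate conical `d`-junta. -/
def IsApproxConicalJunta {n : ℕ} (ε δ : ℝ) (d : ℕ) (f : (Fin n → Bool) → ℝ) : Prop :=
  ∃ (N : ℕ) (lam : Fin N → ℝ) (C h : Fin N → (Fin n → Bool) → ℝ)
    (γ : (Fin n → Bool) → ℝ),
    (∀ i, 0 ≤ lam i) ∧ (∑ i, lam i) ≤ 1 ∧
    (∀ i, IsConjunction d (C i)) ∧ (∀ i, IsDecaying ε (h i)) ∧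
    (∀ x, 0 ≤ γ x) ∧ uexp γ ≤ δ ∧
    ∀ x, f x = (∑ i, lam i * C i x * (1 + h i x)) + γ x

open Classical in
/-- The density `μ` conditioned on the event `S`. -/
def condDensity {Ω : Type*} [Fintype Ω] (μ : Ω → ℝ) (S : Finset Ω) : Ω → ℝ :=
  fun x => if x ∈ S then μ x / prSet μ S else 0

/-- First marginal density of a density on a product. -/
def margFst {Ω : Type*} [Fintype Ω] (μ : Ω × Ω → ℝ) : Ω → ℝ :=
  fun x => (∑ y, μ (x, y)) / (Fintype.card Ω : ℝ)

/-- Second marginal density of a density on a product. -/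
def margSnd {Ω : Type*} [Fintype Ω] (μ : Ω × Ω → ℝ) : Ω → ℝ :=
  fun y => (∑ x, μ (x, y)) / (Fintype.card Ω : ℝ)

open Classical in
/-- `Pr_{(X,Y) ~ μ}[X_I = y.1_I ∧ Y_I = y.2_I]`. -/
def prMarg2 {n : ℕ} {α : Type*} [Fintype α]
    (μ : (Fin n → α) × (Fin n → α) → ℝ) (I : Finset (Fin n))
    (y : (Fin n → α) × (Fin n → α)) : ℝ :=
  (∑ x ∈ Finset.univ.filter
      (fun x : (Fin n → α) × (Fin n → α) =>
        (∀ i ∈ I, x.1 i = y.1 i) ∧ (∀ i ∈ I, x.2 i = y.2 i)), μ x)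
    / (Fintype.card ((Fin n → α) × (Fin n → α)) : ℝ)

/-- Min-entropy of the projection `μ_I` of a density on a product, projecting both factors. -/
def projMinEntropy2 {n : ℕ} {α : Type*} [Fintype α]
    (μ : (Fin n → α) × (Fin n → α) → ℝ) (I : Finset (Fin n)) : ℝ :=
  - Real.logb 2 (⨆ y : (Fin n → α) × (Fin n → α), prMarg2 μ I y)


/-! ### Counting and marginals -/

open Classical in
/-- Unnormalised marginal. -/
def marg {n : ℕ} {α : Type} [Fintype α] (u : (Fin n → α) → ℝ) (T : Finset (Fin n))
    (x : Fin n → α) : ℝ :=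
  ∑ x', if (∀ i ∈ T, x' i = x i) then u x' else 0

open Classical in
lemma ite_forall_prod {n : ℕ} {α : Type} (T : Finset (Fin n)) (x x' : Fin n → α) :
    (if (∀ i ∈ T, x' i = x i) then (1 : ℝ) else 0)
      = ∏ i, (if i ∈ T then (if x' i = x i then (1 : ℝ) else 0) else 1) := by
  split_ifs with h
  · symm
    apply Finset.prod_eq_one
    intro i _
    split_ifs with h1 h2
    · rfl
    · exact absurd (h i h1) h2
    · rfl
  · push Not at h
    obtain ⟨i, hi, hne⟩ := h
    symm
    apply Finset.prod_eq_zero (Finset.mem_univ i)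
    simp [hi, hne]

open Classical in
lemma card_agree {n : ℕ} {α : Type} [Fintype α] (T : Finset (Fin n)) (x : Fin n → α) :
    (∑ x' : Fin n → α, if (∀ i ∈ T, x' i = x i) then (1 : ℝ) else 0)
      * (Fintype.card α : ℝ) ^ T.card = (Fintype.card α : ℝ) ^ n := by
  simp_rw [ite_forall_prod]
  rw [← Fintype.prod_sum (fun i (j : α) => if i ∈ T then (if j = x i then (1 : ℝ) else 0) else 1)]
  have h1 : ∀ i : Fin n, (∑ j : α, if i ∈ T then (if j = x i then (1 : ℝ) else 0) else 1)
      = if i ∈ T then 1 else (Fintype.card α : ℝ) := by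
    intro i
    by_cases hi : i ∈ T <;> simp [hi]
  simp_rw [h1]
  have h2 : (Fintype.card α : ℝ) ^ T.card
      = ∏ i : Fin n, if i ∈ T then (Fintype.card α : ℝ) else 1 := by
    rw [Finset.prod_ite_mem]; simp
  rw [h2, ← Finset.prod_mul_distrib]
  have h3 : ∀ i : Fin n, ((if i ∈ T then (1 : ℝ) else (Fintype.card α : ℝ)) *
      (if i ∈ T then (Fintype.card α : ℝ) else 1)) = (Fintype.card α : ℝ) := by
    intro i; split_ifs <;> simp
  simp_rw [h3]
  simp

/-! ### The gadget -/

def psi (c : ZMod 2) : ℝ := if c = 1 then -1 else 1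

lemma psi_add (a c : ZMod 2) : psi (a + c) = psi a * psi c := by
  have h : ∀ a c : ZMod 2, (a + c = 1 ↔ ¬(a = 1 ↔ c = 1)) := by decide
  unfold psi
  have := h a c
  by_cases ha : a = 1 <;> by_cases hc : c = 1 <;> simp_all

lemma psi_sq (a : ZMod 2) : psi a * psi a = 1 := by
  unfold psi; split_ifs <;> norm_num

lemma psi_sum {ι : Type} (s : Finset ι) (f : ι → ZMod 2) :
    psi (∑ i ∈ s, f i) = ∏ i ∈ s, psi (f i) := by
  classical
  induction s using Finset.induction_on with
  | empty => simp [psi]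
  | insert a s ha ih => rw [Finset.sum_insert ha, Finset.prod_insert ha, psi_add, ih]

def bt (x : Bool) : ZMod 2 := if x then 1 else 0

def fb {b : ℕ} (x : Fin b → Bool) : ZMod 2 := if h : 0 < b then bt (x ⟨0, h⟩) else 0

lemma sgn_gadget {b : ℕ} (x y : Fin b → Bool) :
    sgn (gadget x y) = (∏ i, psi (bt (x i) * bt (y i))) * (psi (fb x) * psi (fb y)) := by
  rw [← psi_sum, ← psi_add, ← psi_add]
  have : sgn (gadget x y) = psi ((∑ i : Fin b, bt (x i) * bt (y i)) + (fb x + fb y)) := by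
    unfold sgn gadget psi fb bt
    by_cases hb : 0 < b <;> simp [hb]
  exact this

lemma sgn_sq (x : Bool) : sgn x * sgn x = 1 := by
  unfold sgn; split_ifs <;> norm_num

open Classical in
lemma gadget_orth {b : ℕ} (y y' : Fin b → Bool) :
    ∑ x : Fin b → Bool, sgn (gadget x y) * sgn (gadget x y')
      = if y = y' then (2 : ℝ) ^ b else 0 := by
  by_cases h : y = y'
  · subst h
    simp [sgn_sq]
  · rw [if_neg h]
    have h1 : ∀ x : Fin b → Bool, sgn (gadget x y) * sgn (gadget x y')
        = (psi (fb y) * psi (fb y')) *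
          ∏ i, (psi (bt (x i) * bt (y i)) * psi (bt (x i) * bt (y' i))) := by
      intro x
      rw [sgn_gadget, sgn_gadget, Finset.prod_mul_distrib]
      have := psi_sq (fb x)
      linear_combination (psi (fb y) * psi (fb y')) *
        (∏ i, psi (bt (x i) * bt (y i))) * (∏ i, psi (bt (x i) * bt (y' i))) * this
    simp_rw [h1]
    rw [← Finset.mul_sum,
      ← Fintype.prod_sum (fun i (j : Bool) => psi (bt j * bt (y i)) * psi (bt j * bt (y' i)))]
    have : ∃ i, y i ≠ y' i := by
      by_contra hc; push Not at hc; exact h (funext hc)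
    obtain ⟨i, hi⟩ := this
    rw [Finset.prod_eq_zero (Finset.mem_univ i), mul_zero]
    rw [Fintype.sum_bool]
    revert hi
    cases y i <;> cases y' i <;> simp [bt, psi]

lemma chi_prod {n : ℕ} (S : Finset (Fin n)) (z : Fin n → Bool) :
    chi S z = ∏ i, if i ∈ S then sgn (z i) else 1 := by
  unfold chi; rw [Finset.prod_ite_mem]; simp

lemma chi_sq {n : ℕ} (S : Finset (Fin n)) (z : Fin n → Bool) : chi S z * chi S z = 1 := by
  unfold chi
  rw [← Finset.prod_mul_distrib]
  simp [sgn_sq]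

lemma abs_chi {n : ℕ} (S : Finset (Fin n)) (z : Fin n → Bool) : |chi S z| = 1 := by
  have h := chi_sq S z
  have : |chi S z| * |chi S z| = 1 := by rw [← abs_mul, h, abs_one]
  nlinarith [abs_nonneg (chi S z)]

open Classical in
lemma gadgetN_orth {n b : ℕ} (S : Finset (Fin n)) (y y' : Fin n → Fin b → Bool) :
    ∑ x : Fin n → Fin b → Bool, chi S (gadgetN x y) * chi S (gadgetN x y')
      = if (∀ i ∈ S, y' i = y i) then ((2 : ℝ) ^ b) ^ n else 0 := by
  have h0 : ∀ x : Fin n → Fin b → Bool, chi S (gadgetN x y) * chi S (gadgetN x y')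
      = ∏ i, (if i ∈ S then sgn (gadget (x i) (y i)) * sgn (gadget (x i) (y' i)) else 1) := by
    intro x
    rw [chi_prod, chi_prod, ← Finset.prod_mul_distrib]
    apply Finset.prod_congr rfl
    intro i _
    unfold gadgetN
    split_ifs <;> simp
  simp_rw [h0]
  rw [← Fintype.prod_sum (fun i (j : Fin b → Bool) =>
    if i ∈ S then sgn (gadget j (y i)) * sgn (gadget j (y' i)) else 1)]
  have h1 : ∀ i : Fin n, (∑ j : Fin b → Bool,
      if i ∈ S then sgn (gadget j (y i)) * sgn (gadget j (y' i)) else 1)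
      = (2 : ℝ) ^ b * (if i ∈ S then (if y' i = y i then (1 : ℝ) else 0) else 1) := by
    intro i
    by_cases hi : i ∈ S
    · simp only [hi, if_true]
      rw [gadget_orth]
      by_cases h : y i = y' i
      · simp [h]
      · simp [h, Ne.symm h]
    · simp [hi]
  simp_rw [h1]
  rw [Finset.prod_mul_distrib]
  have h2 := ite_forall_prod S y y'
  have h3 : ∏ i, (if i ∈ S then (if y' i = y i then (1 : ℝ) else 0) else 1)
      = if (∀ i ∈ S, y' i = y i) then (1 : ℝ) else 0 := by
    convert h2.symm
  rw [h3]
  split_ifs <;> simp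

/-! ### The bilinear Fourier bound -/

lemma sum_marg_swap {n : ℕ} {α : Type} [Fintype α] (u w : (Fin n → α) → ℝ)
    (S : Finset (Fin n)) :
    ∑ x, u x * marg w S x = ∑ x, w x * marg u S x := by
  classical
  unfold marg
  simp_rw [Finset.mul_sum]
  rw [Finset.sum_comm]
  apply Finset.sum_congr rfl; intro x _
  apply Finset.sum_congr rfl; intro y _
  by_cases h : ∀ i ∈ S, x i = y i
  · have h' : ∀ i ∈ S, y i = x i := fun i hi => (h i hi).symm
    rw [if_pos h, if_pos h']; ring
  · have h' : ¬ ∀ i ∈ S, y i = x i := fun h2 => h (fun i hi => (h2 i hi).symm)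
    rw [if_neg h, if_neg h']; ring

lemma fourier_bound {n b : ℕ} (u v : (Fin n → Fin b → Bool) → ℝ) (hu : ∀ x, 0 ≤ u x)
    (hv : ∀ x, 0 ≤ v x) (S : Finset (Fin n)) (P Q : ℝ) (hPn : 0 ≤ P)
    (hP : ∀ x, marg u S x ≤ P) (hQ : ∀ x, marg v S x ≤ Q) :
    (∑ x, ∑ y, u x * v y * chi S (gadgetN x y)) ^ 2
      ≤ (∑ x, u x) * (∑ y, v y) * P * Q * ((2 : ℝ) ^ b) ^ S.card := by
  classical
  set w : (Fin n → Fin b → Bool) → ℝ := fun x => ∑ y, v y * chi S (gadgetN x y) with hw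
  have hq : (Fintype.card (Fin b → Bool) : ℝ) = (2 : ℝ) ^ b := by simp
  have hqpos : (0 : ℝ) < (2 : ℝ) ^ b := by positivity
  have hwdep : ∀ x x' : Fin n → Fin b → Bool, (∀ i ∈ S, x' i = x i) → w x' = w x := by
    intro x x' h
    simp only [hw]
    apply Finset.sum_congr rfl; intro y _
    congr 1
    unfold chi gadgetN
    apply Finset.prod_congr rfl; intro i hi
    rw [h i hi]
  have h1 : ∑ x, ∑ y, u x * v y * chi S (gadgetN x y) = ∑ x, u x * w x := by
    apply Finset.sum_congr rfl; intro x _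
    simp only [hw]; rw [Finset.mul_sum]
    apply Finset.sum_congr rfl; intro y _; ring
  rw [h1]
  have hcs : (∑ x, u x * w x) ^ 2 ≤ (∑ x, u x) * (∑ x, u x * (w x) ^ 2) := by
    have := Finset.sum_mul_sq_le_sq_mul_sq Finset.univ (fun x => Real.sqrt (u x))
      (fun x => Real.sqrt (u x) * w x)
    have e1 : ∀ x, Real.sqrt (u x) * (Real.sqrt (u x) * w x) = u x * w x := by
      intro x; rw [← mul_assoc, Real.mul_self_sqrt (hu x)]
    have e2 : ∀ x, (Real.sqrt (u x)) ^ 2 = u x := fun x => Real.sq_sqrt (hu x)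
    have e3 : ∀ x, (Real.sqrt (u x) * w x) ^ 2 = u x * (w x) ^ 2 := by
      intro x; rw [mul_pow, e2]
    simp_rw [e1, e2, e3] at this
    exact this
  -- sum of w^2
  have hw2 : ∑ x, (w x) ^ 2 = ((2 : ℝ) ^ b) ^ n * ∑ y, v y * marg v S y := by
    have : ∀ x, (w x) ^ 2 = ∑ y, ∑ y', v y * v y' * (chi S (gadgetN x y) * chi S (gadgetN x y')) := by
      intro x
      simp only [hw]
      rw [sq, Finset.sum_mul_sum]
      apply Finset.sum_congr rfl; intro y _
      apply Finset.sum_congr rfl; intro y' _; ring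
    simp_rw [this]
    rw [Finset.sum_comm]
    rw [Finset.mul_sum]
    apply Finset.sum_congr rfl; intro y _
    rw [Finset.sum_comm]
    unfold marg
    rw [Finset.mul_sum, Finset.mul_sum]
    apply Finset.sum_congr rfl; intro y' _
    rw [← Finset.mul_sum, gadgetN_orth]
    split_ifs <;> ring
  have hw2le : ∑ x, (w x) ^ 2 ≤ ((2 : ℝ) ^ b) ^ n * ((∑ y, v y) * Q) := by
    rw [hw2]
    apply mul_le_mul_of_nonneg_left _ (by positivity)
    rw [Finset.sum_mul]
    exact Finset.sum_le_sum (fun y _ => mul_le_mul_of_nonneg_left (hQ y) (hv y))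
  -- averaging
  have hav : (∑ x, u x * (w x) ^ 2) * ((2 : ℝ) ^ b) ^ n
      = (∑ x, (w x) ^ 2 * marg u S x) * ((2 : ℝ) ^ b) ^ S.card := by
    rw [← sum_marg_swap u (fun x => (w x) ^ 2), Finset.sum_mul, Finset.sum_mul]
    apply Finset.sum_congr rfl; intro x _
    have hm : marg (fun x => (w x) ^ 2) S x = (w x) ^ 2 *
        ∑ x' : Fin n → Fin b → Bool, if (∀ i ∈ S, x' i = x i) then (1 : ℝ) else 0 := by
      unfold marg
      rw [Finset.mul_sum]
      apply Finset.sum_congr rfl; intro x' _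
      split_ifs with h
      · show (w x') ^ 2 = (w x) ^ 2 * 1
        rw [hwdep x x' h]; ring
      · ring
    have hc := card_agree S x
    rw [hq] at hc
    rw [hm, ← hc]; ring
  have hle2 : (∑ x, (w x) ^ 2 * marg u S x) ≤ (∑ x, (w x) ^ 2) * P := by
    rw [Finset.sum_mul]
    exact Finset.sum_le_sum (fun x _ => mul_le_mul_of_nonneg_left (hP x) (sq_nonneg _))
  have hfin : (∑ x, u x * (w x) ^ 2) ≤ (∑ y, v y) * Q * P * ((2 : ℝ) ^ b) ^ S.card := by
    have hN : (0 : ℝ) < ((2 : ℝ) ^ b) ^ n := by positivity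
    refine le_of_mul_le_mul_right ?_ hN
    rw [hav]
    calc (∑ x, (w x) ^ 2 * marg u S x) * ((2 : ℝ) ^ b) ^ S.card
        ≤ ((((2 : ℝ) ^ b) ^ n * ((∑ y, v y) * Q)) * P) * ((2 : ℝ) ^ b) ^ S.card := by
          apply mul_le_mul_of_nonneg_right _ (by positivity)
          exact hle2.trans (mul_le_mul_of_nonneg_right hw2le hPn)
      _ = _ := by ring
  calc (∑ x, u x * w x) ^ 2 ≤ (∑ x, u x) * (∑ x, u x * (w x) ^ 2) := hcs
    _ ≤ (∑ x, u x) * ((∑ y, v y) * Q * P * ((2 : ℝ) ^ b) ^ S.card) :=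
        mul_le_mul_of_nonneg_left hfin (Finset.sum_nonneg (fun x _ => hu x))
    _ = _ := by ring

/-! ### Characters and the decomposition predicate -/

lemma chi_orth {n : ℕ} (S T : Finset (Fin n)) :
    uexp (fun z : Fin n → Bool => chi S z * chi T z) = if S = T then 1 else 0 := by
  unfold uexp
  have h0 : ∀ z : Fin n → Bool, chi S z * chi T z
      = ∏ i, ((if i ∈ S then sgn (z i) else 1) * (if i ∈ T then sgn (z i) else 1)) := by
    intro z
    rw [chi_prod, chi_prod, ← Finset.prod_mul_distrib]
  simp_rw [h0]
  rw [← Fintype.prod_sum (fun i (j : Bool) =>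
    (if i ∈ S then sgn j else 1) * (if i ∈ T then sgn j else 1))]
  split_ifs with h
  · subst h
    have : ∀ i : Fin n, (∑ j : Bool, (if i ∈ S then sgn j else 1) * (if i ∈ S then sgn j else 1))
        = (2 : ℝ) := by
      intro i
      by_cases hi : i ∈ S <;> simp [hi, sgn] <;> norm_num
    simp_rw [this]
    simp
  · have : ∃ i, ¬ (i ∈ S ↔ i ∈ T) := by
      by_contra hc; push Not at hc; exact h (Finset.ext hc)
    obtain ⟨i, hi⟩ := this
    rw [Finset.prod_eq_zero (Finset.mem_univ i), zero_div]
    by_cases h1 : i ∈ S <;> by_cases h2 : i ∈ T <;> simp_all [sgn]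

lemma uexp_sum {Ω ι : Type} [Fintype Ω] (s : Finset ι) (f : ι → Ω → ℝ) :
    uexp (fun x => ∑ i ∈ s, f i x) = ∑ i ∈ s, uexp (f i) := by
  unfold uexp
  rw [Finset.sum_comm, Finset.sum_div]

lemma uexp_add {Ω : Type} [Fintype Ω] (f g : Ω → ℝ) :
    uexp (fun x => f x + g x) = uexp f + uexp g := by
  unfold uexp
  rw [Finset.sum_add_distrib, add_div]

lemma uexp_const_mul {Ω : Type} [Fintype Ω] (c : ℝ) (f : Ω → ℝ) :
    uexp (fun x => c * f x) = c * uexp f := by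
  unfold uexp
  rw [← Finset.mul_sum, mul_div_assoc]

lemma fCoeff_sum_chi {n : ℕ} (k : Finset (Fin n) → ℝ) (S : Finset (Fin n)) :
    fCoeff (fun z => ∑ R, k R * chi R z) S = k S := by
  unfold fCoeff
  have : ∀ z : Fin n → Bool, (∑ R, k R * chi R z) * chi S z
      = ∑ R, k R * (chi R z * chi S z) := by
    intro z; rw [Finset.sum_mul]
    apply Finset.sum_congr rfl; intro R _; ring
  simp_rw [this]
  rw [uexp_sum]
  simp_rw [uexp_const_mul, chi_orth]
  simp

/-- Decomposition with error budget `e` and total weight budget `s`. -/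
def Dec {n : ℕ} (ε : ℝ) (d : ℕ) (e s : ℝ) (f : (Fin n → Bool) → ℝ) : Prop :=
  ∃ (ι : Type) (_ : Fintype ι) (lam : ι → ℝ) (C h : ι → (Fin n → Bool) → ℝ)
    (γ : (Fin n → Bool) → ℝ),
    (∀ i, 0 ≤ lam i) ∧ (∑ i, lam i) ≤ s ∧
    (∀ i, IsConjunction d (C i)) ∧ (∀ i, IsDecaying ε (h i)) ∧
    (∀ x, 0 ≤ γ x) ∧ uexp γ ≤ e ∧
    ∀ x, f x = (∑ i, lam i * C i x * (1 + h i x)) + γ x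

lemma Dec.congr {n : ℕ} {ε : ℝ} {d : ℕ} {e s : ℝ} {f g : (Fin n → Bool) → ℝ}
    (h : Dec ε d e s f) (hfg : ∀ x, g x = f x) : Dec ε d e s g := by
  obtain ⟨ι, _, lam, C, hh, γ, h1, h2, h3, h4, h5, h6, h7⟩ := h
  exact ⟨ι, inferInstance, lam, C, hh, γ, h1, h2, h3, h4, h5, h6, fun x => by rw [hfg, h7]⟩

lemma Dec.mono {n : ℕ} {ε : ℝ} {d : ℕ} {e s e' s' : ℝ} {f : (Fin n → Bool) → ℝ}
    (h : Dec ε d e s f) (he : e ≤ e') (hs : s ≤ s') : Dec ε d e' s' f := by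
  obtain ⟨ι, _, lam, C, hh, γ, h1, h2, h3, h4, h5, h6, h7⟩ := h
  exact ⟨ι, inferInstance, lam, C, hh, γ, h1, h2.trans hs, h3, h4, h5, h6.trans he, h7⟩

lemma Dec.of_nonneg {n : ℕ} {ε : ℝ} {d : ℕ} {f : (Fin n → Bool) → ℝ} (hf : ∀ x, 0 ≤ f x) :
    Dec ε d (uexp f) 0 f :=
  ⟨Empty, inferInstance, fun _ => 0, fun _ _ => 0, fun _ _ => 0, f, fun i => i.elim, by simp,
    fun i => i.elim, fun i => i.elim, hf, le_rfl, fun x => by simp⟩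

lemma uexp_zero {Ω : Type} [Fintype Ω] : uexp (fun _ : Ω => (0 : ℝ)) = 0 := by
  simp [uexp]

lemma Dec.zero {n : ℕ} {ε : ℝ} {d : ℕ} : Dec ε d 0 0 (fun _ : Fin n → Bool => (0 : ℝ)) := by
  have := Dec.of_nonneg (ε := ε) (d := d) (f := fun _ : Fin n → Bool => (0 : ℝ)) (fun _ => le_rfl)
  rwa [uexp_zero] at this

lemma Dec.add {n : ℕ} {ε : ℝ} {d : ℕ} {e s e' s' : ℝ} {f g : (Fin n → Bool) → ℝ}
    (hf : Dec ε d e s f) (hg : Dec ε d e' s' g) : Dec ε d (e + e') (s + s') (fun x => f x + g x) := by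
  obtain ⟨ι, _, lam, C, hh, γ, h1, h2, h3, h4, h5, h6, h7⟩ := hf
  obtain ⟨ι', _, lam', C', hh', γ', h1', h2', h3', h4', h5', h6', h7'⟩ := hg
  refine ⟨ι ⊕ ι', inferInstance, Sum.elim lam lam', Sum.elim C C', Sum.elim hh hh',
    fun x => γ x + γ' x, ?_, ?_, ?_, ?_, ?_, ?_, ?_⟩
  · rintro (i | i)
    · exact h1 i
    · exact h1' i
  · rw [Fintype.sum_sum_type]
    exact add_le_add h2 h2'
  · rintro (i | i)
    · exact h3 i
    · exact h3' i
  · rintro (i | i)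
    · exact h4 i
    · exact h4' i
  · intro x; exact add_nonneg (h5 x) (h5' x)
  · rw [uexp_add]; exact add_le_add h6 h6'
  · intro x
    rw [Fintype.sum_sum_type]
    show f x + g x = _
    rw [h7, h7']
    simp only [Sum.elim_inl, Sum.elim_inr]
    ring

lemma Dec.sum {n : ℕ} {ε : ℝ} {d : ℕ} {κ : Type} (t : Finset κ) (e s : κ → ℝ)
    (f : κ → (Fin n → Bool) → ℝ) (hf : ∀ k ∈ t, Dec ε d (e k) (s k) (f k)) :
    Dec ε d (∑ k ∈ t, e k) (∑ k ∈ t, s k) (fun x => ∑ k ∈ t, f k x) := by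
  classical
  induction t using Finset.induction_on with
  | empty => simpa using Dec.zero
  | insert a t ha ih =>
    simp_rw [Finset.sum_insert ha]
    exact Dec.add (hf a (Finset.mem_insert_self _ _))
      (ih (fun k hk => hf k (Finset.mem_insert_of_mem hk)))

lemma Dec.single {n : ℕ} {ε : ℝ} {d : ℕ} {l : ℝ} (hl : 0 ≤ l) {C h : (Fin n → Bool) → ℝ}
    (hC : IsConjunction d C) (hh : IsDecaying ε h) :
    Dec ε d 0 l (fun x => l * C x * (1 + h x)) :=
  ⟨Unit, inferInstance, fun _ => l, fun _ => C, fun _ => h, fun _ => 0, fun _ => hl, by simp,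
    fun _ => hC, fun _ => hh, fun _ => le_rfl, by rw [uexp_zero], fun x => by simp⟩

lemma Dec.toApprox {n : ℕ} {ε : ℝ} {d : ℕ} {e : ℝ} {f : (Fin n → Bool) → ℝ}
    (hf : Dec ε d e 1 f) : IsApproxConicalJunta ε e d f := by
  obtain ⟨ι, _, lam, C, hh, γ, h1, h2, h3, h4, h5, h6, h7⟩ := hf
  let φ := (Fintype.equivFin ι).symm
  refine ⟨Fintype.card ι, lam ∘ φ, C ∘ φ, hh ∘ φ, γ, fun i => h1 _, ?_, fun i => h3 _,
    fun i => h4 _, h5, h6, ?_⟩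
  · rw [show ∑ i, (lam ∘ φ) i = ∑ i, lam i from Equiv.sum_comp φ lam]; exact h2
  · intro x
    rw [h7 x]
    congr 1
    exact (Equiv.sum_comp φ (fun i => lam i * C i x * (1 + hh i x))).symm

lemma decaying_zero {n : ℕ} {ε : ℝ} (hε : 0 ≤ ε) : IsDecaying ε (fun _ : Fin n → Bool => (0 : ℝ)) := by
  refine ⟨uexp_zero, fun S => ?_⟩
  unfold fCoeff
  simp only [zero_mul, uexp_zero, abs_zero]
  positivity

lemma decaying_of_coeffs {n : ℕ} {ε : ℝ} (k : Finset (Fin n) → ℝ) (h0 : k ∅ = 0)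
    (hk : ∀ R, |k R| ≤ ε ^ R.card) : IsDecaying ε (fun z => ∑ R, k R * chi R z) := by
  refine ⟨?_, fun S => ?_⟩
  · have := fCoeff_sum_chi k ∅
    rw [h0] at this
    unfold fCoeff at this
    simpa [chi] using this
  · rw [fCoeff_sum_chi]; exact hk S

/-- One piece of the cone lemma. -/
lemma piece {n : ℕ} {ε : ℝ} {d : ℕ} (hε : 0 ≤ ε) (F I : Finset (Fin n)) (a : Fin n → Bool)
    (hFI : Disjoint F I) (hI : I ≠ ∅) (hcard : F.card + I.card ≤ d) (k : Finset (Fin n) → ℝ) (κ : ℝ) (hκ : 0 < κ)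
    (hk0 : |k ∅| ≤ κ) (hk : ∀ R, R ≠ ∅ → |k R| ≤ κ * ε ^ R.card) :
    Dec ε d 0 (2 * κ) (fun z => if (∀ i ∈ F, z i = a i) then
      2 ^ F.card * (2 * κ + chi I z * ∑ R, k R * chi R z) else 0) := by
  classical
  set D : (Fin n → Bool) → ℝ := fun α => 2 * κ + chi I α * k ∅ with hD
  have hDpos : ∀ α, κ ≤ D α := by
    intro α
    have : |chi I α * k ∅| ≤ κ := by rw [abs_mul, abs_chi, one_mul]; exact hk0
    have := (abs_le.mp this).1
    simp only [hD]; linarith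
  have hDp : ∀ α, 0 < D α := fun α => lt_of_lt_of_le hκ (hDpos α)
  set kk : (Fin n → Bool) → Finset (Fin n) → ℝ :=
    fun α R => if R = ∅ then 0 else chi I α * k R / D α with hkk
  set ab : (Fin n → Bool) → (Fin n → Bool) := fun α i => if i ∈ F then a i else α i with hab
  set CC : (Fin n → Bool) → (Fin n → Bool) → ℝ := fun α z =>
    2 ^ (F ∪ I).card * (if ∀ i ∈ F ∪ I, z i = ab α i then (1 : ℝ) else 0) with hCC
  have hsum : Dec ε d (∑ α : Fin n → Bool, (0 : ℝ)) (∑ α : Fin n → Bool, (2⁻¹ ^ n * D α))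
      (fun z => ∑ α : Fin n → Bool, (2⁻¹ ^ n * D α) * CC α z *
        (1 + ∑ R, kk α R * chi R z)) := by
    apply Dec.sum
    intro α _
    apply Dec.single
    · have := hDp α; positivity
    · exact ⟨F ∪ I, ab α, by rw [Finset.card_union_of_disjoint hFI]; exact hcard, fun x => rfl⟩
    · apply decaying_of_coeffs
      · simp [hkk]
      · intro R
        by_cases hR : R = ∅
        · simp [hkk, hR]
        · simp only [hkk, if_neg hR]
          rw [abs_div, abs_mul, abs_chi, one_mul, abs_of_pos (hDp α), div_le_iff₀ (hDp α)]
          calc |k R| ≤ κ * ε ^ R.card := hk R hR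
            _ ≤ ε ^ R.card * D α := by
              rw [mul_comm]; exact mul_le_mul_of_nonneg_left (hDpos α) (by positivity)
  have hs : (∑ α : Fin n → Bool, ((2 : ℝ)⁻¹ ^ n * D α)) ≤ 2 * κ := by
    rw [← Finset.mul_sum]
    simp only [hD]
    have h1 : ∑ α : Fin n → Bool, chi I α = 0 := by
      have := chi_orth I ∅
      rw [if_neg hI] at this
      unfold uexp at this
      have hc : (Fintype.card (Fin n → Bool) : ℝ) ≠ 0 := by
        simp
      have h2 := (div_eq_zero_iff.mp this).resolve_right hc
      simpa [chi] using h2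
    rw [Finset.sum_add_distrib, ← Finset.sum_mul (f := fun α => chi I α), h1]
    simp only [Finset.sum_const, Finset.card_univ, Fintype.card_pi, Fintype.card_bool,
      Finset.prod_const, Fintype.card_fin, nsmul_eq_mul, zero_mul, add_zero]
    push_cast
    rw [← mul_assoc, ← mul_pow]
    norm_num
  refine (hsum.mono (by simp) hs).congr ?_
  intro z
  -- evaluate the sum
  have hterm : ∀ α : Fin n → Bool, (2⁻¹ ^ n * D α) * CC α z * (1 + ∑ R, kk α R * chi R z)
      = (if (∀ i ∈ F, z i = a i) then (1 : ℝ) else 0) * (2⁻¹ ^ n * 2 ^ (F ∪ I).card *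
        (2 * κ + chi I z * ∑ R, k R * chi R z)) *
          (if (∀ i ∈ I, α i = z i) then (1 : ℝ) else 0) := by
    intro α
    have hiff : (∀ i ∈ F ∪ I, z i = ab α i) ↔ ((∀ i ∈ F, z i = a i) ∧ ∀ i ∈ I, α i = z i) := by
      constructor
      · intro h
        refine ⟨fun i hi => ?_, fun i hi => ?_⟩
        · have := h i (Finset.mem_union_left _ hi)
          simpa [hab, hi] using this
        · have := h i (Finset.mem_union_right _ hi)
          have hn : i ∉ F := fun h2 => Finset.disjoint_left.mp hFI h2 hi
          simp [hab, hn] at this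
          exact this.symm
      · rintro ⟨h1, h2⟩ i hi
        by_cases hiF : i ∈ F
        · simp [hab, hiF, h1 i hiF]
        · have hiI : i ∈ I := (Finset.mem_union.mp hi).resolve_left hiF
          simp [hab, hiF, h2 i hiI]
    simp only [hCC]
    by_cases h1 : ∀ i ∈ F, z i = a i
    · by_cases h2 : ∀ i ∈ I, α i = z i
      · rw [if_pos (hiff.mpr ⟨h1, h2⟩), if_pos h1, if_pos h2]
        have hchi : chi I z = chi I α := by
          unfold chi
          apply Finset.prod_congr rfl
          intro i hi; rw [h2 i hi]
        have hsplit : D α * (1 + ∑ R, kk α R * chi R z)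
            = 2 * κ + chi I α * ∑ R, k R * chi R z := by
          have e1 : ∑ R, k R * chi R z = k ∅ + ∑ R, (if R = ∅ then 0 else k R * chi R z) := by
            rw [← Finset.add_sum_erase _ _ (Finset.mem_univ (∅ : Finset (Fin n))),
              ← Finset.add_sum_erase _ (fun R => if R = ∅ then 0 else k R * chi R z)
                (Finset.mem_univ (∅ : Finset (Fin n)))]
            simp only [if_true, zero_add]
            congr 1
            · simp [chi]
            · apply Finset.sum_congr rfl
              intro R hR
              rw [if_neg (Finset.ne_of_mem_erase hR)]
          rw [e1, mul_add, mul_add, Finset.mul_sum, Finset.mul_sum]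
          have e2 : ∑ R, D α * (kk α R * chi R z)
              = ∑ R, chi I α * (if R = ∅ then 0 else k R * chi R z) := by
            apply Finset.sum_congr rfl
            intro R _
            simp only [hkk]
            split_ifs
            · simp
            · have := (hDp α).ne'
              field_simp
          rw [e2]
          simp only [hD]
          ring
        rw [hchi, ← hsplit]
        ring
      · rw [if_neg (fun h => h2 (hiff.mp h).2), if_neg h2]; ring
    · rw [if_neg (fun h => h1 (hiff.mp h).1), if_neg h1]; ring
  simp_rw [hterm]
  rw [← Finset.mul_sum]
  have hc := card_agree I z
  have hc' : (∑ α : Fin n → Bool, if (∀ i ∈ I, α i = z i) then (1 : ℝ) else 0) * 2 ^ I.card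
      = 2 ^ n := by
    have : (∑ α : Fin n → Bool, if (∀ i ∈ I, α i = z i) then (1 : ℝ) else 0)
      = ∑ x' : Fin n → Bool, @ite ℝ (∀ i ∈ I, x' i = z i) (Classical.propDecidable _) 1 0 := by
      apply Finset.sum_congr rfl; intro x _; split_ifs <;> rfl
    rw [this]
    convert hc using 2
    · apply Finset.sum_congr rfl; intro x _; split_ifs <;> rfl
    · simp
    · simp
  rw [Finset.card_union_of_disjoint hFI, pow_add]
  split_ifs with h1
  · have h2 : (2 : ℝ)⁻¹ ^ n * 2 ^ n = 1 := by rw [← mul_pow]; norm_num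
    set W := (2 * κ + chi I z * ∑ R, k R * chi R z)
    set X := (∑ α : Fin n → Bool, if (∀ i ∈ I, α i = z i) then (1 : ℝ) else 0)
    calc 2 ^ F.card * W = 2 ^ F.card * W * ((2 : ℝ)⁻¹ ^ n * 2 ^ n) := by rw [h2, mul_one]
      _ = 2 ^ F.card * W * ((2 : ℝ)⁻¹ ^ n * (X * 2 ^ I.card)) := by rw [hc']
      _ = _ := by ring
  · ring

/-- The cone lemma. -/
lemma cone {n : ℕ} {ε θ K M : ℝ} {d : ℕ} (hε : 0 ≤ ε) (F : Finset (Fin n)) (a : Fin n → Bool)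
    (hFd : F.card < d) (c : Finset (Fin n) → ℝ) (hK : 0 < K) (hθ : 0 < θ)
    (hc0 : c ∅ = M)
    (hlow : ∀ S, Disjoint S F → S ≠ ∅ → |c S| ≤ K * θ ^ S.card)
    (hhigh : ∀ S, Disjoint S F → d - F.card < S.card →
      |c S| ≤ K * θ ^ (d - F.card) * ε ^ (S.card - (d - F.card)))
    (hsum : 2 * K * ∑ I ∈ (Finset.univ : Finset (Finset (Fin n))).erase ∅, θ ^ I.card ≤ M) :
    Dec ε d 0 M (fun z => if (∀ i ∈ F, z i = a i) then
      2 ^ F.card * ∑ S ∈ Finset.univ.filter (fun S => Disjoint S F), c S * chi S z else 0) := by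
  classical
  set d' := d - F.card with hd'
  have hpick : ∀ S : Finset (Fin n), ∃ I, I ⊆ S ∧ (S.card ≤ d' → I = S) ∧
      (d' ≤ S.card → I.card = d') := by
    intro S
    by_cases h : S.card ≤ d'
    · exact ⟨S, le_rfl, fun _ => rfl, fun h2 => le_antisymm h h2⟩
    · obtain ⟨I, h1, h2⟩ := Finset.exists_subset_card_eq (s := S) (n := d') (by omega)
      exact ⟨I, h1, fun h3 => absurd h3 h, fun _ => h2⟩
  choose pick hp1 hp2 hp3 using hpick
  set good : Finset (Finset (Fin n)) := Finset.univ.filter (fun I => I ≠ ∅ ∧ Disjoint I F ∧ I.card ≤ d')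
    with hgood
  set k : Finset (Fin n) → Finset (Fin n) → ℝ := fun I R =>
    if Disjoint R I ∧ pick (R ∪ I) = I ∧ Disjoint (R ∪ I) F then c (R ∪ I) else 0 with hk
  have hpos : ∀ I : Finset (Fin n), 0 < K * θ ^ I.card := fun I => by positivity
  have hpieces : Dec ε d (∑ I ∈ good, 0) (∑ I ∈ good, 2 * (K * θ ^ I.card))
      (fun z => ∑ I ∈ good, (if (∀ i ∈ F, z i = a i) then
      2 ^ F.card * (2 * (K * θ ^ I.card) + chi I z * ∑ R, k I R * chi R z) else 0)) := by
    apply Dec.sum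
    intro I hI
    obtain ⟨hI0, hIF, hIc⟩ := (Finset.mem_filter.mp hI).2
    apply piece hε F I a hIF.symm hI0 (by omega) (k I) _ (hpos I)
    · simp only [hk]
      split_ifs
      · simp only [Finset.empty_union]; exact hlow I hIF hI0
      · rw [abs_zero]; exact (hpos I).le
    · intro R hR
      simp only [hk]
      split_ifs with h
      · obtain ⟨h1, h2, h3⟩ := h
        have hcard := Finset.card_union_of_disjoint h1
        have hRpos : 0 < R.card := Finset.card_pos.mpr (Finset.nonempty_iff_ne_empty.mpr hR)
        have hgt : d' < (R ∪ I).card := by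
          by_contra hle
          have := hp2 (R ∪ I) (by omega)
          rw [h2] at this
          rw [← this] at hcard
          omega
        have hIcard := hp3 (R ∪ I) hgt.le
        rw [h2] at hIcard
        have := hhigh (R ∪ I) h3 hgt
        rw [hIcard]
        have e : (R ∪ I).card - d' = R.card := by omega
        rwa [e] at this
      · rw [abs_zero]
        have := hpos I
        positivity
  have hsub : ∑ I ∈ good, 2 * (K * θ ^ I.card) ≤ M := by
    refine le_trans ?_ hsum
    rw [Finset.mul_sum]
    simp_rw [← mul_assoc]
    apply Finset.sum_le_sum_of_subset_of_nonneg
    · intro I hI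
      exact Finset.mem_erase.mpr ⟨(Finset.mem_filter.mp hI).2.1, Finset.mem_univ _⟩
    · intro I _ _; positivity
  have hconst : Dec ε d 0 (M - ∑ I ∈ good, 2 * (K * θ ^ I.card))
      (fun z => (M - ∑ I ∈ good, 2 * (K * θ ^ I.card)) *
        (2 ^ F.card * (if ∀ i ∈ F, z i = a i then (1 : ℝ) else 0)) * (1 + 0)) := by
    apply Dec.single (h := fun _ => 0) (sub_nonneg.mpr hsub) ⟨F, a, hFd.le, fun x => rfl⟩
      (decaying_zero hε)
  refine ((hpieces.add hconst).mono (by simp) (by simp)).congr ?_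
  intro z
  by_cases hz : ∀ i ∈ F, z i = a i
  swap
  · simp only [if_neg hz]; simp
  simp only [if_pos hz]
  have hmain : ∑ S ∈ Finset.univ.filter (fun S => Disjoint S F), c S * chi S z
      = M + ∑ I ∈ good, chi I z * ∑ R, k I R * chi R z := by
    have hmaps : ∀ S ∈ Finset.univ.filter (fun S : Finset (Fin n) => Disjoint S F),
        pick S ∈ insert ∅ good := by
      intro S hS
      have hSF := (Finset.mem_filter.mp hS).2
      by_cases h0 : pick S = ∅
      · rw [h0]; exact Finset.mem_insert_self _ _
      · apply Finset.mem_insert_of_mem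
        simp only [hgood, Finset.mem_filter, Finset.mem_univ, true_and]
        refine ⟨h0, Finset.disjoint_of_subset_left (hp1 S) hSF, ?_⟩
        by_cases h : S.card ≤ d'
        · rw [hp2 S h]; exact h
        · rw [hp3 S (by omega)]
    rw [← Finset.sum_fiberwise_of_maps_to hmaps]
    have hng : ∅ ∉ good := by simp [hgood]
    rw [Finset.sum_insert hng]
    congr 1
    · have : (Finset.univ.filter (fun S : Finset (Fin n) => Disjoint S F)).filter
          (fun S => pick S = ∅) = {∅} := by
        ext S
        simp only [Finset.mem_filter, Finset.mem_univ, true_and, Finset.mem_singleton]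
        constructor
        · rintro ⟨_, h⟩
          by_cases h2 : S.card ≤ d'
          · rw [← hp2 S h2, h]
          · have := hp3 S (by omega)
            rw [h] at this
            simp at this
            omega
        · rintro rfl
          exact ⟨by simp, hp2 ∅ (by simp)⟩
      rw [this]
      simp [hc0, chi]
    · apply Finset.sum_congr rfl
      intro I hI
      obtain ⟨hI0, hIF, hIc⟩ := (Finset.mem_filter.mp hI).2
      rw [Finset.mul_sum]
      have e1 : ∑ R, chi I z * (k I R * chi R z) = ∑ R ∈ Finset.univ.filter
          (fun R => Disjoint R I ∧ pick (R ∪ I) = I ∧ Disjoint (R ∪ I) F),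
            c (R ∪ I) * (chi I z * chi R z) := by
        rw [Finset.sum_filter]
        apply Finset.sum_congr rfl
        intro R _
        simp only [hk]
        split_ifs <;> ring
      rw [e1]
      have hIS : ∀ S, pick S = I → I ⊆ S := fun S h => h ▸ hp1 S
      apply Finset.sum_nbij' (fun S => S \ I) (fun R => R ∪ I)
      · intro S hS
        simp only [Finset.mem_filter, Finset.mem_univ, true_and] at hS ⊢
        rw [Finset.sdiff_union_of_subset (hIS S hS.2)]
        exact ⟨Finset.sdiff_disjoint, hS.2, hS.1⟩
      · intro R hR
        simp only [Finset.mem_filter, Finset.mem_univ, true_and] at hR ⊢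
        exact ⟨hR.2.2, hR.2.1⟩
      · intro S hS
        simp only [Finset.mem_filter, Finset.mem_univ, true_and] at hS
        exact Finset.sdiff_union_of_subset (hIS S hS.2)
      · intro R hR
        simp only [Finset.mem_filter, Finset.mem_univ, true_and] at hR
        rw [Finset.union_sdiff_right]
        exact Finset.sdiff_eq_self_of_disjoint hR.1
      · intro S hS
        simp only [Finset.mem_filter, Finset.mem_univ, true_and] at hS
        have hs := hIS S hS.2
        rw [Finset.sdiff_union_of_subset hs]
        congr 1
        unfold chi
        rw [mul_comm, Finset.prod_sdiff hs]
  rw [hmain, ← Finset.mul_sum, Finset.sum_add_distrib]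
  ring

/-! ### Powers of two with real exponent -/

/-- `2 ^ r` for real `r`. -/
def e2 (r : ℝ) : ℝ := (2 : ℝ) ^ r

lemma e2_pos (r : ℝ) : 0 < e2 r := Real.rpow_pos_of_pos (by norm_num) r

lemma e2_add (r s : ℝ) : e2 (r + s) = e2 r * e2 s := Real.rpow_add (by norm_num) r s

lemma e2_zero : e2 0 = 1 := Real.rpow_zero 2

lemma e2_mono {r s : ℝ} (h : r ≤ s) : e2 r ≤ e2 s :=
  Real.rpow_le_rpow_of_exponent_le (by norm_num) h

lemma e2_nat (k : ℕ) : e2 k = 2 ^ k := Real.rpow_natCast 2 k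

lemma e2_mul_nat (r : ℝ) (k : ℕ) : e2 (r * k) = e2 r ^ k := Real.rpow_mul_natCast (by norm_num) r k

lemma e2_lt {r s : ℝ} : e2 r < e2 s ↔ r < s := Real.rpow_lt_rpow_left_iff (by norm_num)

lemma e2_le {r s : ℝ} : e2 r ≤ e2 s ↔ r ≤ s := Real.rpow_le_rpow_left_iff (by norm_num)

lemma e2_logb {x : ℝ} (hx : 0 < x) : e2 (Real.logb 2 x) = x :=
  Real.rpow_logb (by norm_num) (by norm_num) hx

lemma e2_rpow (r s : ℝ) : e2 r ^ s = e2 (r * s) := (Real.rpow_mul (by norm_num) r s).symm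

/-! ### Restrictions and marginals -/

open Classical in
/-- Restriction of a function to an event. -/
def res {X : Type} (u : X → ℝ) (P : X → Prop) (x : X) : ℝ := if P x then u x else 0

lemma res_nonneg {X : Type} {u : X → ℝ} (hu : ∀ x, 0 ≤ u x) (P : X → Prop) (x : X) :
    0 ≤ res u P x := by
  unfold res; split_ifs
  · exact hu x
  · exact le_rfl

lemma res_le {X : Type} {u : X → ℝ} (hu : ∀ x, 0 ≤ u x) (P : X → Prop) (x : X) :
    res u P x ≤ u x := by
  unfold res; split_ifs
  · exact le_rfl
  · exact hu x

lemma res_ne {X : Type} {u : X → ℝ} {P : X → Prop} {x : X} (h : res u P x ≠ 0) :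
    P x ∧ u x ≠ 0 := by
  unfold res at h
  split_ifs at h with h1
  · exact ⟨h1, h⟩
  · exact absurd rfl h

lemma sum_res {X κ : Type} [DecidableEq κ] (u : X → ℝ) (P : X → Prop) (π : X → κ) (s : Finset κ)
    (hs : ∀ x, P x → π x ∈ s) (x : X) :
    ∑ k ∈ s, res u (fun x => P x ∧ π x = k) x = res u P x := by
  unfold res
  by_cases hP : P x
  · rw [Finset.sum_eq_single (π x)]
    · rw [if_pos hP, if_pos ⟨hP, rfl⟩]
    · intro k _ hk
      rw [if_neg (fun h => hk h.2.symm)]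
    · intro h; exact absurd (hs x hP) h
  · simp [hP]

lemma sum_res' {X κ : Type} [DecidableEq κ] [Fintype κ] (u : X → ℝ) (π : X → κ) (x : X) :
    ∑ k, res u (fun x => π x = k) x = u x := by
  unfold res
  rw [Finset.sum_eq_single (π x)]
  · rw [if_pos rfl]
  · intro k _ hk
    rw [if_neg (fun h => hk h.symm)]
  · intro h; exact absurd (Finset.mem_univ _) h

lemma marg_mono {n : ℕ} {α : Type} [Fintype α] {u w : (Fin n → α) → ℝ} (h : ∀ x, u x ≤ w x)
    (T : Finset (Fin n)) (x : Fin n → α) : marg u T x ≤ marg w T x := by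
  unfold marg
  apply Finset.sum_le_sum
  intro y _
  split_ifs
  · exact h y
  · exact le_rfl

lemma marg_nonneg {n : ℕ} {α : Type} [Fintype α] {u : (Fin n → α) → ℝ} (h : ∀ x, 0 ≤ u x)
    (T : Finset (Fin n)) (x : Fin n → α) : 0 ≤ marg u T x := by
  unfold marg
  apply Finset.sum_nonneg
  intro y _
  split_ifs
  · exact h y
  · exact le_rfl

lemma marg_empty {n : ℕ} {α : Type} [Fintype α] (u : (Fin n → α) → ℝ) (x : Fin n → α) :
    marg u ∅ x = ∑ y, u y := by
  simp [marg]

lemma marg_anti {n : ℕ} {α : Type} [Fintype α] {u : (Fin n → α) → ℝ} (h : ∀ x, 0 ≤ u x)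
    {S T : Finset (Fin n)} (hST : S ⊆ T) (x : Fin n → α) : marg u T x ≤ marg u S x := by
  unfold marg
  apply Finset.sum_le_sum
  intro y _
  split_ifs with h1 h2 h2
  · exact le_rfl
  · exact absurd (fun i hi => h1 i (hST hi)) h2
  · exact h y
  · exact le_rfl

lemma marg_congr {n : ℕ} {α : Type} [Fintype α] (u : (Fin n → α) → ℝ)
    (T : Finset (Fin n)) {x x' : Fin n → α} (hx : ∀ i ∈ T, x i = x' i) :
    marg u T x = marg u T x' := by
  unfold marg
  apply Finset.sum_congr rfl
  intro y _
  have : (∀ i ∈ T, y i = x i) ↔ (∀ i ∈ T, y i = x' i) :=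
    ⟨fun h i hi => (h i hi).trans (hx i hi), fun h i hi => (h i hi).trans (hx i hi).symm⟩
  by_cases h : ∀ i ∈ T, y i = x i
  · rw [if_pos h, if_pos (this.mp h)]
  · rw [if_neg h, if_neg (fun h2 => h (this.mpr h2))]

/-! ### The accumulated density -/

/-- Unnormalised version of `AccFn`. -/
def acc {n b : ℕ} (u v : (Fin n → Fin b → Bool) → ℝ) (z : Fin n → Bool) : ℝ :=
  (2 : ℝ) ^ n * ∑ x : Fin n → Fin b → Bool, ∑ y : Fin n → Fin b → Bool,
      if gadgetN x y = z then u x * v y else 0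

lemma acc_nonneg {n b : ℕ} {u v : (Fin n → Fin b → Bool) → ℝ} (hu : ∀ x, 0 ≤ u x)
    (hv : ∀ x, 0 ≤ v x) (z : Fin n → Bool) : 0 ≤ acc u v z := by
  unfold acc
  apply mul_nonneg (by positivity)
  apply Finset.sum_nonneg; intro x _
  apply Finset.sum_nonneg; intro y _
  split_ifs
  · exact mul_nonneg (hu x) (hv y)
  · exact le_rfl

lemma uexp_acc {n b : ℕ} (u v : (Fin n → Fin b → Bool) → ℝ) :
    uexp (acc u v) = (∑ x, u x) * ∑ y, v y := by
  unfold uexp acc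
  rw [← Finset.mul_sum, Finset.sum_comm]
  have : ∀ x : Fin n → Fin b → Bool, ∑ z : Fin n → Bool, ∑ y : Fin n → Fin b → Bool,
      (if gadgetN x y = z then u x * v y else 0) = u x * ∑ y, v y := by
    intro x
    rw [Finset.sum_comm, Finset.mul_sum]
    apply Finset.sum_congr rfl; intro y _
    simp
  simp_rw [this]
  rw [← Finset.sum_mul]
  simp

lemma acc_sum_left {n b : ℕ} {κ : Type} (s : Finset κ) (w : κ → (Fin n → Fin b → Bool) → ℝ)
    (u v : (Fin n → Fin b → Bool) → ℝ) (hw : ∀ x, ∑ k ∈ s, w k x = u x) (z : Fin n → Bool) :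
    acc u v z = ∑ k ∈ s, acc (w k) v z := by
  unfold acc
  rw [← Finset.mul_sum]
  congr 1
  rw [Finset.sum_comm (s := s)]
  apply Finset.sum_congr rfl; intro x _
  rw [Finset.sum_comm (s := s)]
  apply Finset.sum_congr rfl; intro y _
  rw [← hw x, Finset.sum_mul]
  split_ifs <;> simp

lemma acc_sum_right {n b : ℕ} {κ : Type} (s : Finset κ) (w : κ → (Fin n → Fin b → Bool) → ℝ)
    (u v : (Fin n → Fin b → Bool) → ℝ) (hw : ∀ x, ∑ k ∈ s, w k x = v x) (z : Fin n → Bool) :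
    acc u v z = ∑ k ∈ s, acc u (w k) z := by
  unfold acc
  rw [← Finset.mul_sum]
  congr 1
  rw [Finset.sum_comm (s := s)]
  apply Finset.sum_congr rfl; intro x _
  rw [Finset.sum_comm (s := s)]
  apply Finset.sum_congr rfl; intro y _
  rw [← hw y, Finset.mul_sum]
  split_ifs <;> simp

lemma acc_zero_left {n b : ℕ} {u v : (Fin n → Fin b → Bool) → ℝ} (hu : ∀ x, u x = 0)
    (z : Fin n → Bool) : acc u v z = 0 := by
  simp [acc, hu]

lemma acc_zero_right {n b : ℕ} {u v : (Fin n → Fin b → Bool) → ℝ} (hu : ∀ x, v x = 0)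
    (z : Fin n → Bool) : acc u v z = 0 := by
  simp [acc, hu]

/-- Character sums of a rectangle. -/
def cf {n b : ℕ} (u v : (Fin n → Fin b → Bool) → ℝ) (S : Finset (Fin n)) : ℝ :=
  ∑ x, ∑ y, u x * v y * chi S (gadgetN x y)

lemma cf_empty {n b : ℕ} (u v : (Fin n → Fin b → Bool) → ℝ) :
    cf u v ∅ = (∑ x, u x) * ∑ y, v y := by
  simp [cf, chi, Finset.sum_mul_sum]

lemma acc_expand {n b : ℕ} (u v : (Fin n → Fin b → Bool) → ℝ) (F : Finset (Fin n))
    (a : Fin n → Bool) (hF : ∀ x y, u x ≠ 0 → v y ≠ 0 → ∀ i ∈ F, gadgetN x y i = a i)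
    (z : Fin n → Bool) :
    acc u v z = if (∀ i ∈ F, z i = a i) then
      2 ^ F.card * ∑ S ∈ Finset.univ.filter (fun S => Disjoint S F), cf u v S * chi S z else 0 := by
  classical
  have key : ∀ g : Fin n → Bool, (∀ i ∈ F, g i = a i) → (∀ i ∈ F, z i = a i) →
      (2 : ℝ) ^ n * (if g = z then 1 else 0)
        = 2 ^ F.card * ∑ S ∈ Finset.univ.filter (fun S => Disjoint S F), chi S g * chi S z := by
    intro g hg hz
    have e1 : (2 : ℝ) ^ n * (if g = z then 1 else 0) = ∏ i, (1 + sgn (g i) * sgn (z i)) := by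
      split_ifs with h
      · subst h
        simp_rw [sgn_sq]
        norm_num
      · have : ∃ i, g i ≠ z i := by
          by_contra hc; push Not at hc; exact h (funext hc)
        obtain ⟨i, hi⟩ := this
        rw [Finset.prod_eq_zero (Finset.mem_univ i), mul_zero]
        revert hi
        cases g i <;> cases z i <;> simp [sgn]
    rw [e1, ← Finset.prod_mul_prod_compl F]
    congr 1
    · rw [Finset.prod_congr rfl (g := fun _ => (2 : ℝ))]
      · simp
      · intro i hi
        rw [hg i hi, hz i hi, sgn_sq]; norm_num
    · rw [Finset.prod_one_add]
      have : Fᶜ.powerset = Finset.univ.filter (fun S => Disjoint S F) := by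
        ext S
        simp only [Finset.mem_powerset, Finset.mem_filter, Finset.mem_univ, true_and]
        rw [Finset.subset_compl_iff_disjoint_right]
      rw [this]
      apply Finset.sum_congr rfl; intro S _
      unfold chi
      rw [Finset.prod_mul_distrib]
  split_ifs with hz
  · have hrhs : 2 ^ F.card * ∑ S ∈ Finset.univ.filter (fun S => Disjoint S F), cf u v S * chi S z
        = ∑ x, ∑ y, u x * v y * (2 ^ F.card *
          ∑ S ∈ Finset.univ.filter (fun S => Disjoint S F), chi S (gadgetN x y) * chi S z) := by
      unfold cf
      simp_rw [Finset.sum_mul]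
      rw [Finset.sum_comm, Finset.mul_sum]
      apply Finset.sum_congr rfl; intro x _
      rw [Finset.sum_comm, Finset.mul_sum]
      apply Finset.sum_congr rfl; intro y _
      rw [Finset.mul_sum, Finset.mul_sum, Finset.mul_sum]
      apply Finset.sum_congr rfl; intro S _
      ring
    rw [hrhs]
    unfold acc
    rw [Finset.mul_sum]
    apply Finset.sum_congr rfl; intro x _
    rw [Finset.mul_sum]
    apply Finset.sum_congr rfl; intro y _
    by_cases h1 : u x = 0
    · simp [h1]
    by_cases h2 : v y = 0
    · simp [h2]
    rw [← key (gadgetN x y) (hF x y h1 h2) hz]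
    split_ifs <;> ring
  · unfold acc
    apply mul_eq_zero_of_right
    apply Finset.sum_eq_zero; intro x _
    apply Finset.sum_eq_zero; intro y _
    split_ifs with h
    · by_cases h1 : u x = 0
      · simp [h1]
      by_cases h2 : v y = 0
      · simp [h2]
      exact absurd (fun i hi => by rw [← h]; exact hF x y h1 h2 i hi) hz
    · rfl

/-! ### The final stage -/

/-- Truncated Y-threshold. -/
def lm (k : ℕ) : ℝ := if k < 10 then 0.9 - k / 10 else 0

lemma final_stage {n b d : ℕ} (u v : (Fin n → Fin b → Bool) → ℝ) (hu : ∀ x, 0 ≤ u x)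
    (hv : ∀ x, 0 ≤ v x) (F : Finset (Fin n)) (a : Fin n → Bool) (m : Fin n → ℕ)
    (a1 a2 Mu Mv L : ℝ) (hMu : 0 < Mu) (hMv : 0 < Mv)
    (hF : ∀ x y, u x ≠ 0 → v y ≠ 0 → ∀ i ∈ F, gadgetN x y i = a i)
    (hX : ∀ T, Disjoint T F → ∀ x, marg u T x ≤ e2 (a1 - b * T.card))
    (hY : ∀ T, Disjoint T F → ∀ y, marg v T y ≤ e2 (a2 - b * ∑ c ∈ T, (1 - (m c : ℝ) / 10)))
    (tX : ∀ T, Disjoint T F → T ≠ ∅ → ∀ x,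
      marg u T x ≤ Mu * e2 (-(b * ∑ c ∈ T, (0.2 + (m c : ℝ) / 10))))
    (tY : ∀ T, Disjoint T F → ∀ y, marg v T y ≤ Mv * e2 (-(b * ∑ c ∈ T, lm (m c))))
    (hM' : Mu * Mv ≤ 2 * ((∑ x, u x) * ∑ y, v y))
    (hL : Mu * Mv = e2 L) (hLa : L ≤ a1 + a2)
    (hE : 19 / 20 * (a1 + a2) - 11 / 20 * b * (d - F.card) + 9 / 100 * b * ∑ c ∈ Fᶜ, (m c : ℝ)
      < 19 / 20 * L)
    (hb : 20 ≤ b)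
    (hy : ∑ I ∈ (Finset.univ : Finset (Finset (Fin n))).erase ∅, e2 (-(b : ℝ) / 200) ^ I.card
      ≤ 1 / 100) :
    Dec (e2 (-0.5 * b)) d 0 ((∑ x, u x) * ∑ y, v y) (acc u v) := by
  set M' := (∑ x, u x) * ∑ y, v y with hMdef
  set mm := ∑ c ∈ Fᶜ, (m c : ℝ) with hmm
  have hB : (20 : ℝ) ≤ b := by exact_mod_cast hb
  have hMpos : 0 < Mu * Mv := mul_pos hMu hMv
  have hM'pos : 0 < M' := by linarith
  have hmm0 : 0 ≤ mm := Finset.sum_nonneg (fun c _ => by positivity)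
  have hd1 : (F.card : ℝ) < d := by
    by_contra hcon
    push Not at hcon
    have : 0 ≤ (b : ℝ) * (F.card - d) := mul_nonneg (by linarith) (by linarith)
    have : 0 ≤ (b : ℝ) * mm := mul_nonneg (by linarith) hmm0
    nlinarith
  have hd : F.card < d := by exact_mod_cast hd1
  have hcast : ((d - F.card : ℕ) : ℝ) = (d : ℝ) - F.card := by
    rw [Nat.cast_sub hd.le]
  have hθ : (0 : ℝ) < e2 (-0.05 * b) := e2_pos _
  have hcone := cone (n := n) (ε := e2 (-0.5 * b)) (θ := e2 (-0.05 * b)) (K := 2 * M') (M := M')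
    (d := d) (e2_pos _).le F a hd (cf u v) (by linarith) hθ (cf_empty u v) ?_ ?_ ?_
  · exact hcone.congr (acc_expand u v F a hF)
  · intro S hSF hS0
    apply abs_le_of_sq_le_sq _ (by positivity)
    have hfb := fourier_bound u v hu hv S _ _ (mul_nonneg hMu.le (e2_pos _).le) (tX S hSF hS0)
      (tY S hSF)
    refine le_trans hfb ?_
    rw [← e2_nat b, ← e2_mul_nat, ← e2_mul_nat]
    have h1 : M' * (Mu * e2 (-(b * ∑ c ∈ S, (0.2 + (m c : ℝ) / 10)))) *
        (Mv * e2 (-(b * ∑ c ∈ S, lm (m c)))) * e2 (b * S.card)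
        = M' * (Mu * Mv) * e2 (-(b * ∑ c ∈ S, (0.2 + (m c : ℝ) / 10))
          + -(b * ∑ c ∈ S, lm (m c)) + b * S.card) := by
      rw [e2_add, e2_add]; ring
    rw [h1]
    have h2 : -(b * ∑ c ∈ S, (0.2 + (m c : ℝ) / 10)) + -(b * ∑ c ∈ S, lm (m c)) + b * S.card
        ≤ -0.05 * b * S.card + -0.05 * b * S.card := by
      have h3 : (1.1 : ℝ) * S.card ≤ ∑ c ∈ S, (0.2 + (m c : ℝ) / 10) + ∑ c ∈ S, lm (m c) := by
        rw [← Finset.sum_add_distrib]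
        have : (1.1 : ℝ) * S.card = ∑ c ∈ S, (1.1 : ℝ) := by simp [mul_comm]
        rw [this]
        apply Finset.sum_le_sum
        intro c _
        unfold lm
        split_ifs with h
        · linarith
        · have : (10 : ℝ) ≤ m c := by exact_mod_cast (not_lt.mp h)
          linarith
      have h4 := mul_le_mul_of_nonneg_left h3 (by linarith : (0 : ℝ) ≤ b)
      linarith
    calc M' * (Mu * Mv) * e2 _ ≤ M' * (2 * M') * e2 (-0.05 * b * S.card + -0.05 * b * S.card) :=
          mul_le_mul (mul_le_mul_of_nonneg_left hM' hM'pos.le) (e2_mono h2) (e2_pos _).le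
            (by positivity)
      _ = 2 * M' ^ 2 * e2 (-0.05 * b * S.card) ^ 2 := by rw [e2_add]; ring
      _ ≤ (2 * M' * e2 (-0.05 * b * S.card)) ^ 2 := by
          rw [mul_pow, mul_pow]
          apply mul_le_mul_of_nonneg_right _ (by positivity)
          nlinarith [sq_nonneg M']
  · intro S hSF hScard
    apply abs_le_of_sq_le_sq _ (by have := e2_pos (-0.5 * b); positivity)
    have hfb := fourier_bound u v hu hv S _ _ (e2_pos _).le (hX S hSF) (hY S hSF)
    refine le_trans hfb ?_
    rw [← e2_nat b, ← e2_mul_nat, ← e2_mul_nat, ← e2_mul_nat, Nat.cast_sub hScard.le, hcast]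
    have hmS : ∑ c ∈ S, (m c : ℝ) ≤ mm := by
      apply Finset.sum_le_sum_of_subset_of_nonneg
      · exact Finset.subset_compl_iff_disjoint_right.mpr hSF
      · intro c _ _; positivity
    have hsumS : ∑ c ∈ S, (1 - (m c : ℝ) / 10) = S.card - (∑ c ∈ S, (m c : ℝ)) / 10 := by
      rw [Finset.sum_sub_distrib, ← Finset.sum_div]; simp
    rw [hsumS]
    set s : ℝ := (S.card : ℝ) with hs
    set D : ℝ := (d : ℝ) - F.card with hD
    set ms := ∑ c ∈ S, (m c : ℝ) with hms
    have hbm : (b : ℝ) * ms ≤ b * mm := mul_le_mul_of_nonneg_left hmS (by linarith)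
    have hDpos : 0 < D := by simp only [hD]; linarith
    have hbD : 0 < (b : ℝ) * D := mul_pos (by linarith) hDpos
    have hbmm : 0 ≤ (b : ℝ) * mm := mul_nonneg (by linarith) hmm0
    have hexp : a1 - b * s + (a2 - b * (s - ms / 10)) + b * s
        ≤ L + (-0.05 * b * D + -0.5 * b * (s - D)) + (-0.05 * b * D + -0.5 * b * (s - D)) := by
      have hE' : 19 / 20 * (a1 + a2) - 11 / 20 * (b * D) + 9 / 100 * (b * mm) < 19 / 20 * L := by
        linarith
      nlinarith
    calc M' * e2 (a1 - b * s) * e2 (a2 - b * (s - ms / 10)) * e2 (b * s)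
        = M' * e2 (a1 - b * s + (a2 - b * (s - ms / 10)) + b * s) := by
          rw [e2_add, e2_add]; ring
      _ ≤ M' * e2 (L + (-0.05 * b * D + -0.5 * b * (s - D)) +
            (-0.05 * b * D + -0.5 * b * (s - D))) :=
          mul_le_mul_of_nonneg_left (e2_mono hexp) hM'pos.le
      _ = M' * (Mu * Mv) * (e2 (-0.05 * b * D) * e2 (-0.5 * b * (s - D))) ^ 2 := by
          rw [hL]; simp only [e2_add]; ring
      _ ≤ M' * (4 * M') * (e2 (-0.05 * b * D) * e2 (-0.5 * b * (s - D))) ^ 2 := by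
          apply mul_le_mul_of_nonneg_right _ (by positivity)
          apply mul_le_mul_of_nonneg_left _ hM'pos.le
          linarith
      _ = (2 * M' * e2 (-0.05 * b * D) * e2 (-0.5 * b * (s - D))) ^ 2 := by ring
  · have h1 : ∑ I ∈ (Finset.univ : Finset (Finset (Fin n))).erase ∅, e2 (-0.05 * b) ^ I.card
        ≤ 1 / 100 := by
      refine le_trans ?_ hy
      apply Finset.sum_le_sum
      intro I _
      apply pow_le_pow_left₀ hθ.le
      apply e2_mono
      linarith
    nlinarith

/-! ### States of the partition procedure -/

/-- A state of the recursive partition. -/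
structure St {n b : ℕ} (u v : (Fin n → Fin b → Bool) → ℝ) (F : Finset (Fin n)) (a : Fin n → Bool)
    (m : Fin n → ℕ) (a1 a2 : ℝ) : Prop where
  hu : ∀ x, 0 ≤ u x
  hv : ∀ x, 0 ≤ v x
  hm : ∀ c, m c ≤ 10
  hF : ∀ x y, u x ≠ 0 → v y ≠ 0 → ∀ i ∈ F, gadgetN x y i = a i
  hX : ∀ T, Disjoint T F → ∀ x, marg u T x ≤ e2 (a1 - b * T.card)
  hY : ∀ T, Disjoint T F → ∀ y, marg v T y ≤ e2 (a2 - b * ∑ c ∈ T, (1 - (m c : ℝ) / 10))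

lemma ne_zero_of_le {p q : ℝ} (h0 : 0 ≤ p) (h : p ≤ q) (hp : p ≠ 0) : q ≠ 0 := by
  intro hq; exact hp (le_antisymm (hq ▸ h) h0)

lemma St.sub {n b : ℕ} {u v u1 v1 : (Fin n → Fin b → Bool) → ℝ} {F : Finset (Fin n)}
    {a : Fin n → Bool} {m : Fin n → ℕ} {a1 a2 : ℝ} (h : St u v F a m a1 a2)
    (hu1 : ∀ x, 0 ≤ u1 x) (hv1 : ∀ x, 0 ≤ v1 x) (hu : ∀ x, u1 x ≤ u x) (hv : ∀ x, v1 x ≤ v x) :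
    St u1 v1 F a m a1 a2 where
  hu := hu1
  hv := hv1
  hm := h.hm
  hF := fun x y hx hy => h.hF x y (ne_zero_of_le (hu1 x) (hu x) hx) (ne_zero_of_le (hv1 y) (hv y) hy)
  hX := fun T hT x => (marg_mono hu T x).trans (h.hX T hT x)
  hY := fun T hT x => (marg_mono hv T x).trans (h.hY T hT x)

/-- Fixing the coordinates in `I`. -/
lemma St.partX {n b : ℕ} {u v u1 v1 : (Fin n → Fin b → Bool) → ℝ} {F I : Finset (Fin n)}
    {a : Fin n → Bool} {m : Fin n → ℕ} {a1 a2 : ℝ} (h : St u v F a m a1 a2)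
    (hu1 : ∀ x, 0 ≤ u1 x) (hv1 : ∀ x, 0 ≤ v1 x) (hu : ∀ x, u1 x ≤ u x) (hv : ∀ x, v1 x ≤ v x)
    (hIF : Disjoint I F) (x0 : Fin n → Fin b → Bool) (a' : Fin n → Bool)
    (hux : ∀ x, u1 x ≠ 0 → ∀ i ∈ I, x i = x0 i)
    (hvy : ∀ y, v1 y ≠ 0 → ∀ i ∈ I, gadgetN x0 y i = a' i) :
    St u1 v1 (F ∪ I) (fun i => if i ∈ I then a' i else a i) m (a1 - b * I.card) a2 where
  hu := hu1
  hv := hv1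
  hm := h.hm
  hF := by
    intro x y hx hy i hi
    by_cases hiI : i ∈ I
    · simp only [hiI, if_true]
      rw [← hvy y hy i hiI]
      unfold gadgetN
      rw [hux x hx i hiI]
    · simp only [hiI, if_false]
      exact h.hF x y (ne_zero_of_le (hu1 x) (hu x) hx) (ne_zero_of_le (hv1 y) (hv y) hy) i
        ((Finset.mem_union.mp hi).resolve_right hiI)
  hX := by
    intro T hT x
    have hTF : Disjoint T F := Finset.disjoint_of_subset_right Finset.subset_union_left hT
    have hTI : Disjoint T I := Finset.disjoint_of_subset_right Finset.subset_union_right hT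
    have hd : Disjoint (T ∪ I) F := Finset.disjoint_union_left.mpr ⟨hTF, hIF⟩
    have h1 := h.hX (T ∪ I) hd (fun i => if i ∈ I then x0 i else x i)
    rw [Finset.card_union_of_disjoint hTI] at h1
    have h2 : marg u1 T x ≤ marg u (T ∪ I) (fun i => if i ∈ I then x0 i else x i) := by
      unfold marg
      apply Finset.sum_le_sum
      intro x' _
      split_ifs with h3 h4 h4
      · exact hu x'
      · by_contra hcon
        have hne : u1 x' ≠ 0 := fun h0 => hcon (le_of_eq h0)
        apply h4
        intro i hi
        by_cases hiI : i ∈ I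
        · simp only [hiI, if_true]; exact hux x' hne i hiI
        · simp only [hiI, if_false]
          exact h3 i ((Finset.mem_union.mp hi).resolve_right hiI)
      · exact h.hu x'
      · exact le_rfl
    refine h2.trans (h1.trans (le_of_eq ?_))
    congr 1
    push_cast
    ring
  hY := fun T hT x => (marg_mono hv T x).trans
    (h.hY T (Finset.disjoint_of_subset_right Finset.subset_union_left hT) x)

/-- Double counting bound used for the `Y` part. -/
lemma double_count {n : ℕ} {α : Type} [Fintype α] {v v1 : (Fin n → α) → ℝ}
    (hv0 : ∀ x, 0 ≤ v x) (hv1 : ∀ x, 0 ≤ v1 x) (hle : ∀ x, v1 x ≤ v x)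
    (T J : Finset (Fin n)) (thr Q : ℝ) (hthr : ∀ y, v1 y ≠ 0 → thr ≤ marg v J y)
    (hQ : ∀ y, marg v (T ∪ J) y ≤ Q) (y : Fin n → α) :
    marg v1 T y * thr ≤ marg v (T ∩ J) y * Q := by
  classical
  have h1 : marg v1 T y * thr ≤ ∑ y', if (∀ i ∈ T, y' i = y i) then v1 y' * marg v J y' else 0 := by
    unfold marg
    rw [Finset.sum_mul]
    apply Finset.sum_le_sum
    intro y' _
    split_ifs with h
    · by_cases h0 : v1 y' = 0
      · simp [h0]
      · exact mul_le_mul_of_nonneg_left (hthr y' h0) (hv1 y')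
    · simp
  refine h1.trans ?_
  have h2 : (∑ y', if (∀ i ∈ T, y' i = y i) then v1 y' * marg v J y' else 0)
      = ∑ y'', v y'' * ∑ y', if ((∀ i ∈ T, y' i = y i) ∧ ∀ i ∈ J, y'' i = y' i) then v1 y' else 0 := by
    simp_rw [Finset.mul_sum]
    rw [Finset.sum_comm]
    apply Finset.sum_congr rfl; intro y' _
    by_cases h : ∀ i ∈ T, y' i = y i
    · rw [if_pos h]
      unfold marg
      rw [Finset.mul_sum]
      apply Finset.sum_congr rfl; intro y'' _
      by_cases h3 : ∀ i ∈ J, y'' i = y' i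
      · rw [if_pos h3, if_pos ⟨h, h3⟩]; ring
      · rw [if_neg h3, if_neg (fun h4 => h3 h4.2)]; ring
    · rw [if_neg h]
      symm
      apply Finset.sum_eq_zero; intro y'' _
      rw [if_neg (fun h4 => h h4.1), mul_zero]
  rw [h2]
  unfold marg
  rw [Finset.sum_mul]
  apply Finset.sum_le_sum
  intro y'' _
  by_cases hag : ∀ i ∈ T ∩ J, y'' i = y i
  · rw [if_pos hag]
    apply mul_le_mul_of_nonneg_left _ (hv0 y'')
    refine le_trans ?_ (hQ (fun i => if i ∈ T then y i else y'' i))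
    unfold marg
    apply Finset.sum_le_sum
    intro y' _
    by_cases h : (∀ i ∈ T, y' i = y i) ∧ ∀ i ∈ J, y'' i = y' i
    · rw [if_pos h, if_pos]
      · exact hle y'
      · intro i hi
        by_cases hiT : i ∈ T
        · simp only [hiT, if_true]; exact h.1 i hiT
        · simp only [hiT, if_false]
          exact (h.2 i ((Finset.mem_union.mp hi).resolve_left hiT)).symm
    · rw [if_neg h]
      split_ifs
      · exact hv0 y'
      · exact le_rfl
  · rw [if_neg hag, zero_mul]
    apply le_of_eq
    apply mul_eq_zero_of_right
    apply Finset.sum_eq_zero; intro y' _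
    rw [if_neg]
    rintro ⟨h3, h4⟩
    apply hag
    intro i hi
    have := Finset.mem_inter.mp hi
    rw [h4 i this.2, h3 i this.1]

lemma marg_exists {n : ℕ} {α : Type} [Fintype α] {u : (Fin n → α) → ℝ}
    {T : Finset (Fin n)} {x : Fin n → α} (h : marg u T x ≠ 0) :
    ∃ x', (∀ i ∈ T, x' i = x i) ∧ u x' ≠ 0 := by
  unfold marg at h
  obtain ⟨x', _, hx'⟩ := Finset.exists_ne_zero_of_sum_ne_zero h
  by_cases h2 : ∀ i ∈ T, x' i = x i
  · rw [if_pos h2] at hx'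
    exact ⟨x', h2, hx'⟩
  · rw [if_neg h2] at hx'
    exact (hx' rfl).elim

/-- Raising the levels in `J`. -/
lemma St.partY {n b : ℕ} {u v v1 : (Fin n → Fin b → Bool) → ℝ} {F J : Finset (Fin n)}
    {a : Fin n → Bool} {m : Fin n → ℕ} {a1 a2 Mv : ℝ} (h : St u v F a m a1 a2)
    (hv1 : ∀ x, 0 ≤ v1 x) (hv : ∀ x, v1 x ≤ v x) (hMv : Mv = ∑ y, v y) (hMpos : 0 < Mv)
    (hJF : Disjoint J F) (hJm : ∀ c ∈ J, m c < 10)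
    (hheavy : ∀ y, v1 y ≠ 0 → Mv * e2 (-(b * ∑ c ∈ J, (0.9 - (m c : ℝ) / 10))) ≤ marg v J y)
    (hmin : ∀ y, v1 y ≠ 0 → ∀ J' ⊆ J, J' ≠ ∅ → J' ≠ J →
      marg v J' y ≤ Mv * e2 (-(b * ∑ c ∈ J', (0.9 - (m c : ℝ) / 10)))) :
    St u v1 F a (fun c => if c ∈ J then m c + 1 else m c) a1 (a2 - b * J.card / 10) where
  hu := h.hu
  hv := hv1
  hm := by
    intro c
    by_cases hc : c ∈ J
    · simp only [hc, if_true]; have := hJm c hc; omega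
    · simp only [hc, if_false]; exact h.hm c
  hF := fun x y hx hy => h.hF x y hx (ne_zero_of_le (hv1 y) (hv y) hy)
  hX := h.hX
  hY := by
    intro T hT y
    have hsum : ∑ c ∈ T, (1 - (((if c ∈ J then m c + 1 else m c : ℕ)) : ℝ) / 10)
        = ∑ c ∈ T, (1 - (m c : ℝ) / 10) - ((T ∩ J).card : ℝ) / 10 := by
      have e : ((T ∩ J).card : ℝ) / 10 = ∑ c ∈ T, (if c ∈ J then (1 : ℝ) / 10 else 0) := by
        rw [Finset.sum_ite_mem]; simp [div_eq_mul_inv]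
      rw [e, ← Finset.sum_sub_distrib]
      apply Finset.sum_congr rfl; intro c _
      split_ifs
      · push_cast; ring
      · ring
    rw [hsum]
    by_cases hJT : J ⊆ T
    · rw [Finset.inter_eq_right.mpr hJT]
      refine ((marg_mono hv T y).trans (h.hY T hT y)).trans (le_of_eq ?_)
      congr 1; ring
    · by_cases h0 : marg v1 T y = 0
      · rw [h0]; exact (e2_pos _).le
      obtain ⟨y', hy'T, hy'⟩ := marg_exists h0
      have hne : T ∩ J ≠ J := fun he => hJT (Finset.inter_eq_right.mp he)
      have hTJ : marg v (T ∩ J) y ≤ Mv * e2 (-(b * ∑ c ∈ T ∩ J, (0.9 - (m c : ℝ) / 10))) := by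
        rw [marg_congr v (T ∩ J) (x' := y')
          (fun i hi => (hy'T i (Finset.mem_inter.mp hi).1).symm)]
        by_cases he : T ∩ J = ∅
        · rw [he, marg_empty]; simp [e2_zero, hMv]
        · exact hmin y' hy' _ Finset.inter_subset_right he hne
      have hdc := double_count h.hv hv1 hv T J _ _ hheavy
        (h.hY (T ∪ J) (Finset.disjoint_union_left.mpr ⟨hT, hJF⟩)) y
      have hlin : ∀ S : Finset (Fin n), ∑ c ∈ S, (0.9 - (m c : ℝ) / 10)
          = ∑ c ∈ S, (1 - (m c : ℝ) / 10) - (S.card : ℝ) / 10 := by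
        intro S
        have e : (S.card : ℝ) / 10 = ∑ c ∈ S, (1 : ℝ) / 10 := by simp [div_eq_mul_inv]
        rw [e, ← Finset.sum_sub_distrib]
        apply Finset.sum_congr rfl; intro c _; ring
      rw [hlin] at hTJ hdc
      have hui := Finset.sum_union_inter (s₁ := T) (s₂ := J) (f := fun c => (1 - (m c : ℝ) / 10))
      set lT := ∑ c ∈ T, (1 - (m c : ℝ) / 10)
      set lJ := ∑ c ∈ J, (1 - (m c : ℝ) / 10)
      set lI := ∑ c ∈ T ∩ J, (1 - (m c : ℝ) / 10)
      set lU := ∑ c ∈ T ∪ J, (1 - (m c : ℝ) / 10)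
      have h3 := hdc.trans (mul_le_mul_of_nonneg_right hTJ (e2_pos _).le)
      have hthr : 0 < Mv * e2 (-(b * (lJ - (J.card : ℝ) / 10))) := mul_pos hMpos (e2_pos _)
      refine le_of_mul_le_mul_right (h3.trans (le_of_eq ?_)) hthr
      have hexp : (-(b * (lI - ((T ∩ J).card : ℝ) / 10))) + (a2 - b * lU)
          = (a2 - b * J.card / 10 - b * (lT - ((T ∩ J).card : ℝ) / 10))
            + (-(b * (lJ - (J.card : ℝ) / 10))) := by
        have : lU = lT + lJ - lI := by linarith
        rw [this]; ring
      rw [mul_assoc, ← e2_add, hexp, e2_add]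
      ring

/-- Counting heavy restrictions. -/
lemma count_heavy {n b : ℕ} {u : (Fin n → Fin b → Bool) → ℝ} (hu : ∀ x, 0 ≤ u x)
    (I : Finset (Fin n)) (P : (Fin n → Fin b → Bool) → Prop) [DecidablePred P] (R : ℝ)
    (hpos : 0 < ∑ x, u x)
    (hP : ∀ x, P x → (∑ x, u x) * e2 (-R) ≤ marg u I x) :
    (((Finset.univ.filter P).image (fun x => fun i : I => x i)).card : ℝ) ≤ e2 R := by
  classical
  set Ξ := (Finset.univ.filter P).image (fun x => fun i : I => x i) with hΞ
  have h1 : (Ξ.card : ℝ) * ((∑ x, u x) * e2 (-R)) ≤ ∑ x, u x := by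
    calc (Ξ.card : ℝ) * ((∑ x, u x) * e2 (-R)) = ∑ ξ ∈ Ξ, ((∑ x, u x) * e2 (-R)) := by simp
      _ ≤ ∑ ξ ∈ Ξ, ∑ x, (if (fun i : I => x i) = ξ then u x else 0) := by
          apply Finset.sum_le_sum
          intro ξ hξ
          obtain ⟨x0, hx0, rfl⟩ := Finset.mem_image.mp hξ
          refine (hP x0 (Finset.mem_filter.mp hx0).2).trans (le_of_eq ?_)
          unfold marg
          apply Finset.sum_congr rfl; intro x _
          have : (∀ i ∈ I, x i = x0 i) ↔ ((fun i : I => x i) = fun i : I => x0 i) := by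
            constructor
            · intro h; funext i; exact h i i.2
            · intro h i hi; exact congrFun h ⟨i, hi⟩
          by_cases h : ∀ i ∈ I, x i = x0 i
          · rw [if_pos h, if_pos (this.mp h)]
          · rw [if_neg h, if_neg (fun h2 => h (this.mpr h2))]
      _ = ∑ x, ∑ ξ ∈ Ξ, (if (fun i : I => x i) = ξ then u x else 0) := Finset.sum_comm
      _ ≤ ∑ x, u x := by
          apply Finset.sum_le_sum
          intro x _
          rw [Finset.sum_ite_eq]
          split_ifs
          · exact le_rfl
          · exact hu x
  have h2 : (Ξ.card : ℝ) * e2 (-R) ≤ 1 := by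
    refine le_of_mul_le_mul_right ?_ hpos
    linarith
  have h3 : e2 (-R) * e2 R = 1 := by rw [← e2_add]; simp [e2_zero]
  calc (Ξ.card : ℝ) = Ξ.card * e2 (-R) * e2 R := by rw [mul_assoc, h3, mul_one]
    _ ≤ 1 * e2 R := mul_le_mul_of_nonneg_right h2 (e2_pos _).le
    _ = e2 R := one_mul _

/-! ### The induction -/

open Classical in
/-- Size of the support. -/
def suppc {X : Type} [Fintype X] (u : X → ℝ) : ℕ := (Finset.univ.filter (fun x => u x ≠ 0)).card

lemma suppc_mono {X : Type} [Fintype X] {u w : X → ℝ} (h : ∀ x, u x ≠ 0 → w x ≠ 0) :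
    suppc u ≤ suppc w := by
  classical
  unfold suppc
  apply Finset.card_le_card
  intro x hx
  simp only [Finset.mem_filter, Finset.mem_univ, true_and] at hx ⊢
  exact h x hx

lemma suppc_lt {X : Type} [Fintype X] {u w : X → ℝ} (h : ∀ x, u x ≠ 0 → w x ≠ 0)
    {x0 : X} (h1 : u x0 = 0) (h2 : w x0 ≠ 0) : suppc u < suppc w := by
  classical
  unfold suppc
  apply Finset.card_lt_card
  refine ⟨fun x hx => ?_, fun hsub => ?_⟩
  · simp only [Finset.mem_filter, Finset.mem_univ, true_and] at hx ⊢
    exact h x hx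
  · have := hsub (Finset.mem_filter.mpr ⟨Finset.mem_univ x0, h2⟩)
    exact (Finset.mem_filter.mp this).2 h1

/-- Termination measure. -/
def meas {n b : ℕ} (u v : (Fin n → Fin b → Bool) → ℝ) (F : Finset (Fin n)) (m : Fin n → ℕ) : ℕ :=
  suppc u + suppc v + ∑ c ∈ Fᶜ, (11 - m c)

/-- Exponent of the error bound. -/
def EE {n : ℕ} (b d : ℕ) (F : Finset (Fin n)) (m : Fin n → ℕ) (a1 a2 : ℝ) : ℝ :=
  19 / 20 * (a1 + a2) - 11 / 20 * b * (d - F.card) + 9 / 100 * b * ∑ c ∈ Fᶜ, (m c : ℝ)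

/-- The inductive claim. -/
def Claim (n b d N : ℕ) : Prop :=
  ∀ (u v : (Fin n → Fin b → Bool) → ℝ) (F : Finset (Fin n)) (a : Fin n → Bool) (m : Fin n → ℕ)
    (a1 a2 : ℝ), St u v F a m a1 a2 → meas u v F m < N →
    Dec (e2 (-0.5 * b)) d (((∑ x, u x) * ∑ y, v y) ^ (1 / 20 : ℝ) * e2 (EE b d F m a1 a2))
      ((∑ x, u x) * ∑ y, v y) (acc u v)

lemma sum_le_sum' {X : Type} [Fintype X] {u w : X → ℝ} (h : ∀ x, u x ≤ w x) :
    ∑ x, u x ≤ ∑ x, w x := Finset.sum_le_sum (fun x _ => h x)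

lemma sum_nonneg' {X : Type} [Fintype X] {u : X → ℝ} (h : ∀ x, 0 ≤ u x) :
    0 ≤ ∑ x, u x := Finset.sum_nonneg (fun x _ => h x)

lemma stepX {n b d N : ℕ} (hb : 20 ≤ b) (IH : Claim n b d N)
    {u v : (Fin n → Fin b → Bool) → ℝ} {F : Finset (Fin n)} {a : Fin n → Bool}
    {m : Fin n → ℕ} {a1 a2 : ℝ} (h : St u v F a m a1 a2) (hmeas : meas u v F m < N + 1)
    (hMu : 0 < ∑ x, u x)
    (I : Finset (Fin n)) (hI0 : I ≠ ∅) (P : (Fin n → Fin b → Bool) → Prop)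
    (hP1 : ∀ x, P x → Disjoint I F)
    (hP2 : ∀ x, P x →
      (∑ x, u x) * e2 (-(b * ∑ c ∈ I, (0.2 + (m c : ℝ) / 10))) ≤ marg u I x) :
    Dec (e2 (-0.5 * b)) d (((∑ x, u x) * ∑ y, v y) ^ (1 / 20 : ℝ) * e2 (EE b d F m a1 a2)
      * e2 (-(b : ℝ) / 200) ^ I.card)
      ((∑ x, res u P x) * ∑ y, v y) (acc (res u P) v) := by
  classical
  have hB : (20 : ℝ) ≤ b := by exact_mod_cast hb
  set M := (∑ x, u x) * ∑ y, v y with hM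
  have hM0 : 0 ≤ M := mul_nonneg hMu.le (sum_nonneg' h.hv)
  by_cases hex : ∃ x, P x
  swap
  · have hz : ∀ x, res u P x = 0 := fun x => if_neg (fun hp => hex ⟨x, hp⟩)
    refine (Dec.zero.mono ?_ ?_).congr (acc_zero_left hz)
    · have := e2_pos (EE b d F m a1 a2)
      have := e2_pos (-(b : ℝ) / 200)
      positivity
    · simp [hz]
  obtain ⟨xx, hxx⟩ := hex
  have hIF := hP1 xx hxx
  set Ξ := (Finset.univ.filter P).image (fun x => fun i : I => x i) with hΞ
  set R := b * ∑ c ∈ I, (0.2 + (m c : ℝ) / 10) with hR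
  have hcount : (Ξ.card : ℝ) ≤ e2 R := count_heavy h.hu I P R hMu hP2
  set uu : (I → Fin b → Bool) → (Fin n → Fin b → Bool) → ℝ :=
    fun ξ => res u (fun x => P x ∧ (fun i : I => x i) = ξ) with huu
  have husum : ∀ x, ∑ ξ ∈ Ξ, uu ξ x = res u P x := by
    intro x
    apply sum_res
    intro x hx
    exact Finset.mem_image.mpr ⟨x, Finset.mem_filter.mpr ⟨Finset.mem_univ _, hx⟩, rfl⟩
  set E' := EE b d (F ∪ I) m (a1 - b * I.card) a2 with hE'
  set A := M ^ (1 / 20 : ℝ) * e2 E' with hA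
  have hA0 : 0 ≤ A := mul_nonneg (Real.rpow_nonneg hM0 _) (e2_pos _).le
  have hξ : ∀ ξ ∈ Ξ, Dec (e2 (-0.5 * b)) d (2 ^ I.card * A)
      ((∑ x, uu ξ x) * ∑ y, v y) (acc (uu ξ) v) := by
    intro ξ hξ
    obtain ⟨x0, _, hx0⟩ := Finset.mem_image.mp hξ
    set vv : (I → Bool) → (Fin n → Fin b → Bool) → ℝ :=
      fun β => res v (fun y => (fun i : I => gadgetN x0 y i) = β) with hvv
    have hvsum : ∀ y, ∑ β, vv β y = v y := fun y => sum_res' v _ y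
    have hpart : ∀ β ∈ (Finset.univ : Finset (I → Bool)), Dec (e2 (-0.5 * b)) d A
        ((∑ x, uu ξ x) * ∑ y, vv β y) (acc (uu ξ) (vv β)) := by
      intro β _
      have hle : (∑ x, uu ξ x) * ∑ y, vv β y ≤ M :=
        mul_le_mul (sum_le_sum' (res_le h.hu _)) (sum_le_sum' (res_le h.hv _))
          (sum_nonneg' (res_nonneg h.hv _)) hMu.le
      have hst : St (uu ξ) (vv β) (F ∪ I)
          (fun i => if i ∈ I then (if hi : i ∈ I then β ⟨i, hi⟩ else false) else a i) m
          (a1 - b * I.card) a2 := by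
        apply h.partX (res_nonneg h.hu _) (res_nonneg h.hv _) (res_le h.hu _) (res_le h.hv _)
          hIF x0 (fun i => if hi : i ∈ I then β ⟨i, hi⟩ else false)
        · intro x hx i hi
          have h1 := (res_ne hx).1.2
          rw [← hx0] at h1
          exact congrFun h1 ⟨i, hi⟩
        · intro y hy i hi
          have h1 := (res_ne hy).1
          simp only [hi, dif_pos]
          exact congrFun h1 ⟨i, hi⟩
      refine (IH _ _ _ _ _ _ _ hst ?_).mono ?_ le_rfl
      · have h1 : suppc (uu ξ) ≤ suppc u := suppc_mono (fun x hx => (res_ne hx).2)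
        have h2 : suppc (vv β) ≤ suppc v := suppc_mono (fun x hx => (res_ne hx).2)
        have h3 : ∑ c ∈ (F ∪ I)ᶜ, (11 - m c) < ∑ c ∈ Fᶜ, (11 - m c) := by
          obtain ⟨i, hi⟩ := Finset.nonempty_iff_ne_empty.mpr hI0
          apply Finset.sum_lt_sum_of_subset (i := i)
          · exact Finset.compl_subset_compl.mpr Finset.subset_union_left
          · exact Finset.mem_compl.mpr (Finset.disjoint_left.mp hIF hi)
          · simp [hi]
          · have := h.hm i; omega
          · intro j _ _; omega
        unfold meas at hmeas ⊢
        omega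
      · apply mul_le_mul_of_nonneg_right _ (e2_pos _).le
        apply Real.rpow_le_rpow _ hle (by norm_num)
        exact mul_nonneg (sum_nonneg' (res_nonneg h.hu _)) (sum_nonneg' (res_nonneg h.hv _))
    have hD := Dec.sum Finset.univ _ _ _ hpart
    refine (hD.mono ?_ ?_).congr (fun z => acc_sum_right _ vv _ _ hvsum z)
    · simp
    · rw [← Finset.mul_sum, Finset.sum_comm]
      simp_rw [hvsum]
      exact le_rfl
  have hD := Dec.sum Ξ _ _ _ hξ
  refine (hD.mono ?_ ?_).congr (fun z => acc_sum_left _ uu _ _ husum z)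
  · rw [Finset.sum_const, nsmul_eq_mul]
    have hexp : R + (I.card + E') ≤ EE b d F m a1 a2 + -(b : ℝ) / 200 * I.card := by
      have hcard : ((F ∪ I).card : ℝ) = F.card + I.card := by
        rw [Finset.card_union_of_disjoint hIF.symm]; push_cast; ring
      have hsplit : ∑ c ∈ Fᶜ, (m c : ℝ) = ∑ c ∈ (F ∪ I)ᶜ, (m c : ℝ) + ∑ c ∈ I, (m c : ℝ) := by
        have hsub : I ⊆ Fᶜ := Finset.subset_compl_iff_disjoint_right.mpr hIF
        rw [← Finset.sum_sdiff hsub]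
        congr 2
        ext c
        simp only [Finset.mem_sdiff, Finset.mem_compl, Finset.mem_union]
        tauto
      have hRR : R = b * (0.2 * I.card + (∑ c ∈ I, (m c : ℝ)) / 10) := by
        rw [hR, Finset.sum_add_distrib, ← Finset.sum_div]
        simp [mul_comm]
      have hmI : ∑ c ∈ I, (m c : ℝ) ≤ 10 * I.card := by
        have : (10 : ℝ) * I.card = ∑ c ∈ I, (10 : ℝ) := by simp [mul_comm]
        rw [this]
        apply Finset.sum_le_sum
        intro c _
        exact_mod_cast h.hm c
      have hbm := mul_le_mul_of_nonneg_left hmI (by linarith : (0 : ℝ) ≤ b)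
      have hIc : (0 : ℝ) ≤ I.card := by positivity
      have hbI : (20 : ℝ) * I.card ≤ b * I.card := mul_le_mul_of_nonneg_right hB hIc
      rw [hE']
      unfold EE
      rw [hcard, hsplit, hRR]
      nlinarith
    have h2 := e2_mono hexp
    rw [e2_add, e2_add, e2_add, e2_nat, e2_mul_nat] at h2
    have hMp := Real.rpow_nonneg hM0 (1 / 20 : ℝ)
    calc (Ξ.card : ℝ) * (2 ^ I.card * A) ≤ e2 R * (2 ^ I.card * A) :=
          mul_le_mul_of_nonneg_right hcount (by positivity)
      _ = M ^ (1 / 20 : ℝ) * (e2 R * (2 ^ I.card * e2 E')) := by rw [hA]; ring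
      _ ≤ M ^ (1 / 20 : ℝ) * (e2 (EE b d F m a1 a2) * e2 (-(b : ℝ) / 200) ^ I.card) :=
          mul_le_mul_of_nonneg_left h2 hMp
      _ = _ := by ring
  · rw [← Finset.sum_mul, Finset.sum_comm]
    simp_rw [husum]
    exact le_rfl

lemma stepY {n b d N : ℕ} (IH : Claim n b d N)
    {u v : (Fin n → Fin b → Bool) → ℝ} {F : Finset (Fin n)} {a : Fin n → Bool}
    {m : Fin n → ℕ} {a1 a2 M : ℝ} (h : St u v F a m a1 a2) (hmeas : meas u v F m < N + 1)
    (hMv : 0 < ∑ y, v y) (hM : (∑ x, u x) * ∑ y, v y ≤ M)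
    (J : Finset (Fin n)) (hJ0 : J ≠ ∅) (P : (Fin n → Fin b → Bool) → Prop)
    (hP1 : ∀ x, P x → Disjoint J F) (hP3 : ∀ x, P x → ∀ c ∈ J, m c < 10)
    (hP2 : ∀ y, P y →
      (∑ x, v x) * e2 (-(b * ∑ c ∈ J, (0.9 - (m c : ℝ) / 10))) ≤ marg v J y)
    (hP4 : ∀ y, P y → ∀ J' ⊆ J, J' ≠ ∅ → J' ≠ J →
      marg v J' y ≤ (∑ x, v x) * e2 (-(b * ∑ c ∈ J', (0.9 - (m c : ℝ) / 10)))) :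
    Dec (e2 (-0.5 * b)) d (M ^ (1 / 20 : ℝ) * e2 (EE b d F m a1 a2)
      * e2 (-(b : ℝ) / 200) ^ J.card)
      ((∑ x, u x) * ∑ y, res v P y) (acc u (res v P)) := by
  classical
  have hM0 : 0 ≤ M := le_trans (mul_nonneg (sum_nonneg' h.hu) (sum_nonneg' h.hv)) hM
  by_cases hex : ∃ x, P x
  swap
  · have hz : ∀ x, res v P x = 0 := fun x => if_neg (fun hp => hex ⟨x, hp⟩)
    refine (Dec.zero.mono ?_ ?_).congr (acc_zero_right hz)
    · have := e2_pos (EE b d F m a1 a2)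
      have := e2_pos (-(b : ℝ) / 200)
      positivity
    · simp [hz]
  obtain ⟨xx, hxx⟩ := hex
  have hJF := hP1 xx hxx
  have hJm := hP3 xx hxx
  have hst := h.partY (res_nonneg h.hv P) (res_le h.hv P) rfl hMv hJF hJm
    (fun y hy => hP2 y (res_ne hy).1) (fun y hy => hP4 y (res_ne hy).1)
  have hsubJ : J ⊆ Fᶜ := Finset.subset_compl_iff_disjoint_right.mpr hJF
  refine (IH _ _ _ _ _ _ _ hst ?_).mono ?_ le_rfl
  · have h2 : suppc (res v P) ≤ suppc v := suppc_mono (fun x hx => (res_ne hx).2)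
    have h3 : ∑ c ∈ Fᶜ, (11 - (if c ∈ J then m c + 1 else m c)) < ∑ c ∈ Fᶜ, (11 - m c) := by
      obtain ⟨i, hi⟩ := Finset.nonempty_iff_ne_empty.mpr hJ0
      apply Finset.sum_lt_sum
      · intro c _; split_ifs <;> omega
      · refine ⟨i, hsubJ hi, ?_⟩
        rw [if_pos hi]
        have := hJm i hi
        omega
    unfold meas at hmeas ⊢
    beta_reduce
    omega
  · have hle : (∑ x, u x) * ∑ y, res v P y ≤ M :=
      le_trans (mul_le_mul_of_nonneg_left (sum_le_sum' (res_le h.hv _)) (sum_nonneg' h.hu)) hM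
    have hexp : EE b d F (fun c => if c ∈ J then m c + 1 else m c) a1 (a2 - b * J.card / 10)
        = EE b d F m a1 a2 + -(b : ℝ) / 200 * J.card := by
      have hs : ∑ c ∈ Fᶜ, ((if c ∈ J then m c + 1 else m c : ℕ) : ℝ)
          = ∑ c ∈ Fᶜ, (m c : ℝ) + J.card := by
        have e : (J.card : ℝ) = ∑ c ∈ Fᶜ, (if c ∈ J then (1 : ℝ) else 0) := by
          rw [Finset.sum_ite_mem, Finset.inter_eq_right.mpr hsubJ]; simp
        rw [e, ← Finset.sum_add_distrib]
        apply Finset.sum_congr rfl; intro c _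
        split_ifs
        · push_cast; ring
        · ring
      unfold EE
      rw [hs]
      ring
    rw [hexp, e2_add, e2_mul_nat, ← mul_assoc]
    apply mul_le_mul_of_nonneg_right _ (by have := e2_pos (-(b : ℝ) / 200); positivity)
    apply mul_le_mul_of_nonneg_right _ (e2_pos _).le
    apply Real.rpow_le_rpow _ hle (by norm_num)
    exact mul_nonneg (sum_nonneg' h.hu) (sum_nonneg' (res_nonneg h.hv _))

lemma half_rpow : ((1 : ℝ) / 2) ^ (1 / 20 : ℝ) ≤ 0.97 := by
  have h1 : ((1 : ℝ) / 2) ^ (1 / 20 : ℝ) ≤ ((0.97 : ℝ) ^ (20 : ℕ)) ^ (1 / 20 : ℝ) :=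
    Real.rpow_le_rpow (by norm_num) (by norm_num) (by norm_num)
  have h2 : ((0.97 : ℝ) ^ (20 : ℕ)) ^ (1 / 20 : ℝ) = 0.97 := by
    have := Real.pow_rpow_inv_natCast (x := (0.97 : ℝ)) (n := 20) (by norm_num) (by norm_num)
    rw [← this]
    norm_num
  rw [h2] at h1
  exact h1

/-- Trimmed marginals on the `Y` side. -/
lemma trimY {n b : ℕ} {v v' : (Fin n → Fin b → Bool) → ℝ} (hv0 : ∀ y, 0 ≤ v' y)
    (hle : ∀ y, v' y ≤ v y) (F : Finset (Fin n)) (m : Fin n → ℕ)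
    (hno : ∀ y, v' y ≠ 0 → ∀ J, J ≠ ∅ → Disjoint J F → (∀ c ∈ J, m c < 10) →
      marg v J y ≤ (∑ y, v y) * e2 (-(b * ∑ c ∈ J, (0.9 - (m c : ℝ) / 10))))
    (T : Finset (Fin n)) (hT : Disjoint T F) (y : Fin n → Fin b → Bool) :
    marg v' T y ≤ (∑ y, v y) * e2 (-(b * ∑ c ∈ T, lm (m c))) := by
  classical
  set T0 := T.filter (fun c => m c < 10) with hT0
  have hsum : ∑ c ∈ T, lm (m c) = ∑ c ∈ T0, (0.9 - (m c : ℝ) / 10) := by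
    rw [hT0, Finset.sum_filter]
    rfl
  rw [hsum]
  have hsub : T0 ⊆ T := Finset.filter_subset _ _
  refine (marg_anti hv0 hsub y).trans ?_
  by_cases he : T0 = ∅
  · rw [he, marg_empty]
    simp only [Finset.sum_empty, mul_zero, neg_zero, e2_zero, mul_one]
    exact sum_le_sum' hle
  by_cases h0 : marg v' T0 y = 0
  · rw [h0]
    exact mul_nonneg (sum_nonneg' (fun y => (hv0 y).trans (hle y))) (e2_pos _).le
  obtain ⟨y', hy'T, hy'⟩ := marg_exists h0
  refine (marg_mono hle T0 y).trans ?_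
  rw [marg_congr v T0 (x' := y') (fun i hi => (hy'T i hi).symm)]
  exact hno y' hy' T0 he (Finset.disjoint_of_subset_left hsub hT)
    (fun c hc => (Finset.mem_filter.mp hc).2)

lemma claim_all {n b d : ℕ} (hb : 20 ≤ b)
    (hy : ∑ I ∈ (Finset.univ : Finset (Finset (Fin n))).erase ∅, e2 (-(b : ℝ) / 200) ^ I.card
      ≤ 1 / 100) (N : ℕ) : Claim n b d N := by
  classical
  induction N with
  | zero => intro u v F a m a1 a2 _ h; exact absurd h (Nat.not_lt_zero _)
  | succ N IH =>
  intro u v F a m a1 a2 h hmeas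
  set Mu := ∑ x, u x with hMu
  set Mv := ∑ y, v y with hMv
  set M := Mu * Mv with hM
  have hMu0 : 0 ≤ Mu := sum_nonneg' h.hu
  have hMv0 : 0 ≤ Mv := sum_nonneg' h.hv
  have hM0 : 0 ≤ M := mul_nonneg hMu0 hMv0
  set E := EE b d F m a1 a2 with hE
  set bound := M ^ (1 / 20 : ℝ) * e2 E with hbound
  have hbound0 : 0 ≤ bound := mul_nonneg (Real.rpow_nonneg hM0 _) (e2_pos _).le
  by_cases hcase : M ≤ bound
  · refine (Dec.of_nonneg (acc_nonneg h.hu h.hv)).mono ?_ hM0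
    rw [uexp_acc]; exact hcase
  push Not at hcase
  have hMpos : 0 < M := lt_of_le_of_lt hbound0 hcase
  have hMupos : 0 < Mu := lt_of_le_of_ne hMu0 (fun h0 => by rw [hM, ← h0, zero_mul] at hMpos; exact lt_irrefl _ hMpos)
  have hMvpos : 0 < Mv := lt_of_le_of_ne hMv0 (fun h0 => by rw [hM, ← h0, mul_zero] at hMpos; exact lt_irrefl _ hMpos)
  set L := Real.logb 2 M with hL
  have hML : M = e2 L := (e2_logb hMpos).symm
  have hEL : E < 19 / 20 * L := by
    rw [hbound, hML, e2_rpow, ← e2_add, e2_lt] at hcase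
    linarith
  have hLa : L ≤ a1 + a2 := by
    rw [← e2_le, ← hML, e2_add]
    have h1 := h.hX ∅ (by simp) (fun _ _ => false)
    have h2 := h.hY ∅ (by simp) (fun _ _ => false)
    rw [marg_empty] at h1 h2
    simp only [Finset.card_empty, Finset.sum_empty, Nat.cast_zero, mul_zero, sub_zero] at h1 h2
    exact mul_le_mul h1 h2 hMv0 (e2_pos _).le
  -- violators
  set VX : (Fin n → Fin b → Bool) → Finset (Fin n) → Prop := fun x I =>
    I ≠ ∅ ∧ Disjoint I F ∧ Mu * e2 (-(b * ∑ c ∈ I, (0.2 + (m c : ℝ) / 10))) ≤ marg u I x with hVX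
  set VY : (Fin n → Fin b → Bool) → Finset (Fin n) → Prop := fun y J =>
    J ≠ ∅ ∧ Disjoint J F ∧ (∀ c ∈ J, m c < 10) ∧
      Mv * e2 (-(b * ∑ c ∈ J, (0.9 - (m c : ℝ) / 10))) ≤ marg v J y with hVY
  have hpX : ∀ x, ∃ I, (I ≠ ∅ → VX x I) ∧ (I = ∅ → ∀ I', ¬ VX x I') := by
    intro x
    by_cases hex : ∃ I, VX x I
    · obtain ⟨I, hI⟩ := hex
      exact ⟨I, fun _ => hI, fun h0 => absurd h0 hI.1⟩
    · push Not at hex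
      exact ⟨∅, fun h0 => absurd rfl h0, fun _ => hex⟩
  have hpY : ∀ y, ∃ J, (J ≠ ∅ → VY y J ∧ ∀ J' ⊆ J, J' ≠ J → ¬ VY y J') ∧
      (J = ∅ → ∀ J', ¬ VY y J') := by
    intro y
    by_cases hex : ∃ J, VY y J
    · obtain ⟨J0, hJ0⟩ := hex
      obtain ⟨J, hJ, hmin⟩ := Finset.exists_min_image (Finset.univ.filter (VY y)) Finset.card
        ⟨J0, Finset.mem_filter.mpr ⟨Finset.mem_univ _, hJ0⟩⟩
      have hJ' := (Finset.mem_filter.mp hJ).2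
      refine ⟨J, fun _ => ⟨hJ', fun J' hsub hne hV => ?_⟩, fun h0 => absurd h0 hJ'.1⟩
      have h1 := hmin J' (Finset.mem_filter.mpr ⟨Finset.mem_univ _, hV⟩)
      exact hne (Finset.eq_of_subset_of_card_le hsub h1)
    · push Not at hex
      exact ⟨∅, fun h0 => absurd rfl h0, fun _ => hex⟩
  choose pX hpX1 hpX2 using hpX
  choose pY hpY1 hpY2 using hpY
  set uu : Finset (Fin n) → (Fin n → Fin b → Bool) → ℝ := fun I => res u (fun x => pX x = I) with huu
  set vv : Finset (Fin n) → (Fin n → Fin b → Bool) → ℝ := fun J => res v (fun y => pY y = J) with hvv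
  have husum : ∀ x, ∑ I, uu I x = u x := fun x => sum_res' u pX x
  have hvsum : ∀ y, ∑ J, vv J y = v y := fun y => sum_res' v pY y
  have huu0 : ∀ I x, 0 ≤ uu I x := fun I => res_nonneg h.hu _
  have hvv0 : ∀ I x, 0 ≤ vv I x := fun I => res_nonneg h.hv _
  have huule : ∀ I x, uu I x ≤ u x := fun I => res_le h.hu _
  have hvvle : ∀ I x, vv I x ≤ v x := fun I => res_le h.hv _
  set M' := (∑ x, uu ∅ x) * ∑ y, vv ∅ y with hM'
  have hM'0 : 0 ≤ M' := mul_nonneg (sum_nonneg' (huu0 ∅)) (sum_nonneg' (hvv0 ∅))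
  have hst' : St (uu ∅) (vv ∅) F a m a1 a2 :=
    h.sub (huu0 ∅) (hvv0 ∅) (huule ∅) (hvvle ∅)
  set Y := e2 (-(b : ℝ) / 200) with hYdef
  -- X parts
  have hXparts : ∀ I ∈ (Finset.univ : Finset (Finset (Fin n))).erase ∅,
      Dec (e2 (-0.5 * b)) d (bound * Y ^ I.card) ((∑ x, uu I x) * Mv) (acc (uu I) v) := by
    intro I hI
    have hI0 := Finset.ne_of_mem_erase hI
    apply stepX hb IH h hmeas hMupos I hI0 (fun x => pX x = I)
    · rintro x rfl; exact (hpX1 x hI0).2.1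
    · rintro x rfl; exact (hpX1 x hI0).2.2
  -- Y parts
  have hYparts : ∀ J ∈ (Finset.univ : Finset (Finset (Fin n))).erase ∅,
      Dec (e2 (-0.5 * b)) d (bound * Y ^ J.card) ((∑ x, uu ∅ x) * ∑ y, vv J y)
        (acc (uu ∅) (vv J)) := by
    intro J hJ
    have hJ0 := Finset.ne_of_mem_erase hJ
    have hstu : St (uu ∅) v F a m a1 a2 := h.sub (huu0 ∅) h.hv (huule ∅) (fun _ => le_rfl)
    have hms : meas (uu ∅) v F m < N + 1 := by
      have h1 : suppc (uu ∅) ≤ suppc u := suppc_mono (fun x hx => (res_ne hx).2)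
      unfold meas at hmeas ⊢
      omega
    apply stepY IH hstu hms hMvpos (M := M) _ J hJ0 (fun y => pY y = J)
    · rintro y rfl; exact (hpY1 y hJ0).1.2.1
    · rintro y rfl; exact (hpY1 y hJ0).1.2.2.1
    · rintro y rfl; exact (hpY1 y hJ0).1.2.2.2
    · rintro y rfl J' hsub h0 hne
      have hno := (hpY1 y hJ0).2 J' hsub hne
      by_contra hcon
      push Not at hcon
      refine hno ⟨h0, ?_, ?_, hcon.le⟩
      · exact Finset.disjoint_of_subset_left hsub (hpY1 y hJ0).1.2.1
      · intro c hc; exact (hpY1 y hJ0).1.2.2.1 c (hsub hc)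
    · exact mul_le_mul_of_nonneg_right (sum_le_sum' (huule ∅)) hMv0
  -- trimmed part
  have hfin : Dec (e2 (-0.5 * b)) d (0.97 * bound) M' (acc (uu ∅) (vv ∅)) := by
    by_cases hhalf : M' < M / 2
    · refine (IH _ _ _ _ _ _ _ hst' ?_).mono ?_ le_rfl
      · have h1 : suppc (uu ∅) ≤ suppc u := suppc_mono (fun x hx => (res_ne hx).2)
        have h2 : suppc (vv ∅) ≤ suppc v := suppc_mono (fun x hx => (res_ne hx).2)
        have h3 : suppc (uu ∅) < suppc u ∨ suppc (vv ∅) < suppc v := by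
          by_contra hcon
          push Not at hcon
          have e1 : ∀ x, uu ∅ x = u x := by
            intro x
            by_contra hne
            have hu0 : uu ∅ x = 0 := by
              simp only [huu, res] at hne ⊢
              split_ifs at hne ⊢ with hp
              · exact absurd rfl hne
              · rfl
            have := suppc_lt (u := uu ∅) (w := u) (fun x hx => (res_ne hx).2) hu0
              (fun h0 => hne (hu0.trans h0.symm))
            omega
          have e2' : ∀ x, vv ∅ x = v x := by
            intro x
            by_contra hne
            have hu0 : vv ∅ x = 0 := by
              simp only [hvv, res] at hne ⊢
              split_ifs at hne ⊢ with hp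
              · exact absurd rfl hne
              · rfl
            have := suppc_lt (u := vv ∅) (w := v) (fun x hx => (res_ne hx).2) hu0
              (fun h0 => hne (hu0.trans h0.symm))
            omega
          have : M' = M := by
            rw [hM', hM, Finset.sum_congr rfl (fun x _ => e1 x),
              Finset.sum_congr rfl (fun x _ => e2' x)]
          linarith
        unfold meas at hmeas ⊢
        omega
      · have h1 : M' ^ (1 / 20 : ℝ) ≤ (M * (1 / 2)) ^ (1 / 20 : ℝ) :=
          Real.rpow_le_rpow hM'0 (by linarith) (by norm_num)
        rw [Real.mul_rpow hM0 (by norm_num)] at h1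
        have h2 : M ^ (1 / 20 : ℝ) * ((1 : ℝ) / 2) ^ (1 / 20 : ℝ) ≤ M ^ (1 / 20 : ℝ) * 0.97 :=
          mul_le_mul_of_nonneg_left half_rpow (Real.rpow_nonneg hM0 _)
        have h3 := mul_le_mul_of_nonneg_right (h1.trans h2) (e2_pos E).le
        refine h3.trans (le_of_eq ?_)
        rw [hbound]; ring
    · push Not at hhalf
      refine (final_stage (d := d) (uu ∅) (vv ∅) (huu0 ∅) (hvv0 ∅) F a m a1 a2 Mu Mv L hMupos hMvpos
        hst'.hF hst'.hX hst'.hY ?_ ?_ (by linarith) hML hLa hEL hb hy).mono (by positivity) le_rfl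
      · intro T hT hT0 x
        by_cases h0 : marg (uu ∅) T x = 0
        · rw [h0]; exact mul_nonneg hMu0 (e2_pos _).le
        obtain ⟨x', hxT, hx'⟩ := marg_exists h0
        refine (marg_mono (huule ∅) T x).trans ?_
        rw [marg_congr u T (x' := x') (fun i hi => (hxT i hi).symm)]
        have hno := hpX2 x' (res_ne hx').1 T
        by_contra hcon
        push Not at hcon
        exact hno ⟨hT0, hT, hcon.le⟩
      · intro T hT y
        apply trimY (hvv0 ∅) (hvvle ∅) F m _ T hT y
        intro y' hy' J hJ0 hJF hJm
        have hno := hpY2 y' (res_ne hy').1 J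
        by_contra hcon
        push Not at hcon
        exact hno ⟨hJ0, hJF, hJm, hcon.le⟩
  have hall := ((Dec.sum _ _ _ _ hXparts).add (Dec.sum _ _ _ _ hYparts)).add hfin
  refine (hall.mono ?_ ?_).congr ?_
  · rw [← Finset.mul_sum]
    have := mul_le_mul_of_nonneg_left hy hbound0
    linarith
  · rw [← Finset.sum_mul, ← Finset.mul_sum, hM']
    have h1 : Mu = (∑ x, uu ∅ x) + ∑ I ∈ (Finset.univ : Finset (Finset (Fin n))).erase ∅,
        ∑ x, uu I x := by
      rw [Finset.add_sum_erase _ (fun I => ∑ x, uu I x) (Finset.mem_univ _), Finset.sum_comm]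
      simp_rw [husum]
      rfl
    have h2 : Mv = (∑ x, vv ∅ x) + ∑ I ∈ (Finset.univ : Finset (Finset (Fin n))).erase ∅,
        ∑ x, vv I x := by
      rw [Finset.add_sum_erase _ (fun I => ∑ x, vv I x) (Finset.mem_univ _), Finset.sum_comm]
      simp_rw [hvsum]
      rfl
    apply le_of_eq
    rw [hM]
    linear_combination (-Mv) * h1 - (∑ x, uu ∅ x) * h2
  · intro z
    rw [acc_sum_left Finset.univ uu u v husum z,
      ← Finset.add_sum_erase _ (fun I => acc (uu I) v z) (Finset.mem_univ ∅),
      acc_sum_right Finset.univ vv (uu ∅) v hvsum z,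
      ← Finset.add_sum_erase _ (fun I => acc (uu ∅) (vv I) z) (Finset.mem_univ ∅)]
    ring

/-! ### Assembling the theorem -/

lemma Dec.full {n d : ℕ} {ε : ℝ} (hε : 0 ≤ ε) (hnd : n ≤ d) {f : (Fin n → Bool) → ℝ}
    (hf : ∀ x, 0 ≤ f x) : Dec ε d 0 (uexp f) f := by
  classical
  have h1 : Dec ε d (∑ _α : Fin n → Bool, (0 : ℝ)) (∑ α : Fin n → Bool, f α / 2 ^ n)
      (fun z => ∑ α : Fin n → Bool, (f α / 2 ^ n) *
        (2 ^ (Finset.univ : Finset (Fin n)).card *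
          (if ∀ i ∈ (Finset.univ : Finset (Fin n)), z i = α i then (1 : ℝ) else 0)) * (1 + 0)) := by
    apply Dec.sum
    intro α _
    apply Dec.single (h := fun _ => 0) (div_nonneg (hf α) (by positivity)) _ (decaying_zero hε)
    exact ⟨Finset.univ, α, by simpa using hnd, fun x => rfl⟩
  refine (h1.mono (by simp) ?_).congr ?_
  · unfold uexp
    rw [← Finset.sum_div]
    simp
  · intro z
    rw [Finset.sum_eq_single z]
    · simp
    · intro α _ hne
      rw [if_neg]
      · simp
      · intro hall
        exact hne (funext (fun i => (hall i (Finset.mem_univ i)).symm))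
    · intro hz; exact absurd (Finset.mem_univ z) hz

lemma sum_pow_card (n : ℕ) (Y : ℝ) :
    ∑ I ∈ (Finset.univ : Finset (Finset (Fin n))).erase ∅, Y ^ I.card = (1 + Y) ^ n - 1 := by
  have h1 := Finset.prod_one_add (R := ℝ) (f := fun _ : Fin n => Y) (Finset.univ : Finset (Fin n))
  simp only [Finset.prod_const, Finset.card_univ, Fintype.card_fin, Finset.powerset_univ] at h1
  rw [h1, ← Finset.add_sum_erase _ _ (Finset.mem_univ (∅ : Finset (Fin n)))]
  simp

lemma small_sum_bound {n b : ℕ} (hn : 2 ≤ n) (hb : 4000 * Real.logb 2 (n : ℝ) ≤ (b : ℝ)) :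
    20 ≤ b ∧ ∑ I ∈ (Finset.univ : Finset (Finset (Fin n))).erase ∅, e2 (-(b : ℝ) / 200) ^ I.card
      ≤ 1 / 100 := by
  have hn2 : (2 : ℝ) ≤ n := by exact_mod_cast hn
  have hl1 : 1 ≤ Real.logb 2 (n : ℝ) := by
    rw [Real.le_logb_iff_rpow_le (by norm_num) (by linarith)]
    simpa using hn2
  have hb1 : (4000 : ℝ) ≤ b := by linarith
  refine ⟨by have : (20 : ℝ) ≤ b := by linarith
             exact_mod_cast this, ?_⟩
  rw [sum_pow_card]
  set Y := e2 (-(b : ℝ) / 200) with hY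
  have hYpos : 0 < Y := e2_pos _
  have hnY : n * Y ≤ 1 / 200 := by
    have h1 : (n : ℝ) = e2 (Real.logb 2 n) := (e2_logb (by linarith)).symm
    rw [h1, hY, ← e2_add]
    have h2 : e2 (Real.logb 2 (n : ℝ) + -(b : ℝ) / 200) ≤ e2 (-(19 : ℕ)) := by
      apply e2_mono
      push_cast
      linarith
    refine h2.trans ?_
    unfold e2
    rw [Real.rpow_neg (by norm_num), Real.rpow_natCast]
    norm_num
  have h1 : (1 + Y) ^ n ≤ Real.exp (n * Y) := by
    rw [Real.exp_nat_mul]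
    apply pow_le_pow_left₀ (by linarith)
    have := Real.add_one_le_exp Y
    linarith
  have h2 : Real.exp (n * Y) ≤ Real.exp (1 / 200) := Real.exp_le_exp.mpr hnY
  have h3 : Real.exp (1 / 200) ≤ 101 / 100 := by
    have h4 := Real.add_one_le_exp (-(1 / 200) : ℝ)
    have h5 : Real.exp (1 / 200) * Real.exp (-(1 / 200)) = 1 := by
      rw [← Real.exp_add]; simp
    nlinarith [Real.exp_pos (1 / 200)]
  linarith

/-- Marginals of a density with large min-entropy. -/
lemma marg_init {n b : ℕ} {u : (Fin n → Fin b → Bool) → ℝ} (hu : IsDensity u)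
    (T : Finset (Fin n)) (x : Fin n → Fin b → Bool) :
    marg (fun x => u x / (Fintype.card (Fin n → Fin b → Bool) : ℝ)) T x
      ≤ e2 ((b * n - minEntropy u) - b * T.card) := by
  classical
  set Q : ℝ := (Fintype.card (Fin n → Fin b → Bool) : ℝ) with hQ
  have hQpos : 0 < Q := by
    rw [hQ]; exact_mod_cast Fintype.card_pos
  set S := ⨆ x, u x / Q with hS
  have hle : ∀ x, u x / Q ≤ S := fun x =>
    le_ciSup (f := fun x => u x / Q) (Set.finite_range _).bddAbove x
  have hsum : ∑ x, u x / Q = 1 := by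
    rw [← Finset.sum_div]; exact hu.2
  have hSpos : 0 < S := by
    by_contra hcon
    push Not at hcon
    have : ∑ x, u x / Q ≤ 0 := Finset.sum_nonpos (fun x _ => (hle x).trans hcon)
    linarith
  have hSe : S = e2 (-minEntropy u) := by
    unfold minEntropy
    rw [neg_neg, e2_logb hSpos]
  have hm : marg (fun x => u x / Q) T x
      ≤ S * ∑ x' : Fin n → Fin b → Bool, if (∀ i ∈ T, x' i = x i) then (1 : ℝ) else 0 := by
    unfold marg
    rw [Finset.mul_sum]
    apply Finset.sum_le_sum
    intro x' _
    split_ifs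
    · rw [mul_one]; exact hle x'
    · simp
  have hc : (∑ x' : Fin n → Fin b → Bool, if (∀ i ∈ T, x' i = x i) then (1 : ℝ) else 0)
      * e2 (b * T.card) = e2 (b * n) := by
    have h1 := card_agree T x
    rw [e2_mul_nat, e2_mul_nat, e2_nat]
    have h2 : (Fintype.card (Fin b → Bool) : ℝ) = 2 ^ b := by simp
    rw [h2] at h1
    convert h1
  refine hm.trans (le_of_eq ?_)
  have h4 : e2 (b * T.card) * e2 (-(b * T.card)) = 1 := by
    rw [← e2_add]; simp [e2_zero]
  have e : (b * n - minEntropy u) - b * T.card = -minEntropy u + b * n + -(b * T.card) := by ring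
  rw [e, e2_add, e2_add, ← hSe, ← hc]
  set W := (∑ x' : Fin n → Fin b → Bool, if (∀ i ∈ T, x' i = x i) then (1 : ℝ) else 0)
  linear_combination (-(S * W)) * h4

lemma AccFn_eq {n b : ℕ} (u v : (Fin n → Fin b → Bool) → ℝ) (z : Fin n → Bool) :
    AccFn u v z = acc (fun x => u x / (Fintype.card (Fin n → Fin b → Bool) : ℝ))
      (fun x => v x / (Fintype.card (Fin n → Fin b → Bool) : ℝ)) z := by
  unfold AccFn acc
  rw [mul_div_assoc, Finset.sum_div]
  congr 1
  apply Finset.sum_congr rfl; intro x _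
  rw [Finset.sum_div]
  apply Finset.sum_congr rfl; intro y _
  split_ifs
  · rw [sq, div_mul_div_comm]
  · simp

/-- the junta approximation theorem for `Acc_{u,v}` of high
min-entropy rectangles. -/
theorem stmt5 :
    ∃ α₂ : ℝ, 1 ≤ α₂ ∧
      ∀ (n b : ℕ), 1 ≤ n →
      ∀ (u v : (Fin n → Fin b → Bool) → ℝ), IsDensity u → IsDensity v →
      ∀ t : ℝ, 2 * (b : ℝ) * ((n : ℝ) - t) ≤ minEntropy u + minEntropy v →
      α₂ * Real.logb 2 (n : ℝ) ≤ (b : ℝ) →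
      ∀ d : ℕ, α₂ * t ≤ (d : ℝ) →
      IsApproxConicalJunta ((2 : ℝ) ^ (-(0.5 : ℝ) * (b : ℝ)))
        ((2 : ℝ) ^ (-(0.5 : ℝ) * (b : ℝ) * (d : ℝ))) d (AccFn u v) := by
  refine ⟨4000, by norm_num, ?_⟩
  intro n b hn u v hu hv t hH hb d hd
  have hcong := AccFn_eq u v
  set Q : ℝ := (Fintype.card (Fin n → Fin b → Bool) : ℝ) with hQ
  have hQpos : 0 < Q := by
    rw [hQ]; exact_mod_cast Fintype.card_pos
  set p : (Fin n → Fin b → Bool) → ℝ := fun x => u x / Q with hp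
  set r : (Fin n → Fin b → Bool) → ℝ := fun x => v x / Q with hr
  have hp0 : ∀ x, 0 ≤ p x := fun x => div_nonneg (hu.1 x) hQpos.le
  have hr0 : ∀ x, 0 ≤ r x := fun x => div_nonneg (hv.1 x) hQpos.le
  have hps : ∑ x, p x = 1 := by
    simp only [hp]; rw [← Finset.sum_div]; exact hu.2
  have hrs : ∑ x, r x = 1 := by
    simp only [hr]; rw [← Finset.sum_div]; exact hv.2
  have hue : uexp (acc p r) = 1 := by rw [uexp_acc, hps, hrs, one_mul]
  apply Dec.toApprox
  refine Dec.congr (f := acc p r) ?_ hcong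
  have hδ : (0 : ℝ) ≤ (2 : ℝ) ^ (-(0.5 : ℝ) * (b : ℝ) * (d : ℝ)) := by positivity
  have hε : (0 : ℝ) ≤ (2 : ℝ) ^ (-(0.5 : ℝ) * (b : ℝ)) := by positivity
  rcases Nat.eq_zero_or_pos d with hd0 | hd0
  · refine (Dec.of_nonneg (acc_nonneg hp0 hr0)).mono ?_ (by norm_num)
    rw [hue, hd0]; simp
  rcases Nat.lt_or_ge n 2 with hn2 | hn2
  · refine (Dec.full hε (by omega) (acc_nonneg hp0 hr0)).mono hδ hue.le
  obtain ⟨hb20, hy⟩ := small_sum_bound hn2 hb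
  have hst : St p r ∅ (fun _ => false) (fun _ => 0) (b * n - minEntropy u)
      (b * n - minEntropy v) := by
    refine ⟨hp0, hr0, fun _ => by norm_num, fun x y _ _ i hi => absurd hi (by simp), ?_, ?_⟩
    · intro T _ x; exact marg_init hu T x
    · intro T _ y
      refine (marg_init hv T y).trans (le_of_eq ?_)
      simp
  have hmain := claim_all (d := d) hb20 hy _ _ _ _ _ _ _ _ hst (Nat.lt_succ_self _)
  rw [hps, hrs] at hmain
  refine hmain.mono ?_ (by norm_num)
  rw [one_mul, Real.one_rpow, one_mul]
  apply e2_mono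
  unfold EE
  simp only [Finset.card_empty, Nat.cast_zero, Finset.sum_const_zero, mul_zero, sub_zero, add_zero]
  have hbpos : (20 : ℝ) ≤ b := by exact_mod_cast hb20
  have h1 := mul_le_mul_of_nonneg_left hd (by linarith : (0 : ℝ) ≤ b)
  have h2 : 0 ≤ (b : ℝ) * d := by positivity
  nlinarith
end
end

section
/- Let μ be a density on [q]^n × [q]^n such that for all I ⊆ [n], H∞(μ_I) ≥ 1.9·(log₂ q)·|I| − t, where μ_I is the projection of μ onto the coordinates in I (in both factors). Then for every d ∈ ℕ there exists a partition [q]^n × [q]^n = (⋃_{i∈[N]} R_i) ∪ Error, where each R_i = A_i × B_i is a combinatorial rectangle, such that: (i) for each i ∈ [N], if (X_i, Y_i) ~ μ|_{R_i}, then X_i and Y_i are aligned d-CBD random variables; and (ii) μ(Error) ≤ 2^t·(d·q^{-0.05})^d. -/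
open scoped BigOperators

noncomputable section

/-! ### Helper material -/

lemma prSet_nonneg' {Ω : Type*} [Fintype Ω] {μ : Ω → ℝ} (h : ∀ x, 0 ≤ μ x) (S : Finset Ω) :
    0 ≤ prSet μ S :=
  div_nonneg (Finset.sum_nonneg fun x _ => h x) (Nat.cast_nonneg _)

lemma prSet_mono' {Ω : Type*} [Fintype Ω] {μ : Ω → ℝ} (h : ∀ x, 0 ≤ μ x) {S T : Finset Ω}
    (hST : S ⊆ T) : prSet μ S ≤ prSet μ T :=
  div_le_div_of_nonneg_right (Finset.sum_le_sum_of_subset_of_nonneg hST fun x _ _ => h x)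
    (Nat.cast_nonneg _)

lemma prSet_partition {Ω κ : Type*} [Fintype Ω] [Fintype κ] (μ : Ω → ℝ) (T : Finset Ω)
    (S : κ → Finset Ω) (hd : ∀ k l, k ≠ l → Disjoint (S k) (S l))
    (hT : ∀ p, p ∈ T ↔ ∃ k, p ∈ S k) : prSet μ T = ∑ k, prSet μ (S k) := by
  classical
  have : T = Finset.univ.biUnion S := by
    ext p; simp [hT]
  unfold prSet
  rw [this, Finset.sum_biUnion (fun k _ l _ h => hd k l h), Finset.sum_div]

/-- A set tiled by finitely many disjoint good rectangles. -/
def Tiled {V : Type} (good : Finset V → Finset V → Prop) (S : Finset (V × V)) : Prop :=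
  ∃ (ι : Type) (_ : Fintype ι) (A B : ι → Finset V),
    (∀ i j, i ≠ j → Disjoint (A i ×ˢ B i) (A j ×ˢ B j)) ∧
    (∀ p, p ∈ S ↔ ∃ i, p ∈ A i ×ˢ B i) ∧ ∀ i, good (A i) (B i)

lemma Tiled.empty {V : Type} (good : Finset V → Finset V → Prop) : Tiled good ∅ :=
  ⟨Empty, inferInstance, Empty.elim, Empty.elim, fun i => i.elim, by simp, fun i => i.elim⟩

lemma Tiled.single {V : Type} {good : Finset V → Finset V → Prop} {A B : Finset V}
    (h : good A B) : Tiled good (A ×ˢ B) :=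
  ⟨Unit, inferInstance, fun _ => A, fun _ => B, fun i j hij => (hij rfl).elim, by simp,
    fun _ => h⟩

lemma Tiled.sigma {V κ : Type} [Fintype κ] {good : Finset V → Finset V → Prop}
    (S : κ → Finset (V × V)) (T : Finset (V × V))
    (hd : ∀ k l, k ≠ l → Disjoint (S k) (S l))
    (hT : ∀ p, p ∈ T ↔ ∃ k, p ∈ S k) (h : ∀ k, Tiled good (S k)) : Tiled good T := by
  classical
  choose ι hι A B hdis hmem hgood using h
  refine ⟨Σ k, ι k, inferInstance, fun x => A x.1 x.2, fun x => B x.1 x.2, ?_, ?_, ?_⟩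
  · rintro ⟨k, i⟩ ⟨l, j⟩ hne
    by_cases hkl : k = l
    · subst hkl
      exact hdis k i j (fun h => hne (by rw [h]))
    · rw [Finset.disjoint_left]
      intro p hp hp'
      exact (Finset.disjoint_left.1 (hd k l hkl)) ((hmem k p).2 ⟨i, hp⟩) ((hmem l p).2 ⟨j, hp'⟩)
  · intro p
    rw [hT]
    constructor
    · rintro ⟨k, hk⟩
      obtain ⟨i, hi⟩ := (hmem k p).1 hk
      exact ⟨⟨k, i⟩, hi⟩
    · rintro ⟨⟨k, i⟩, hi⟩
      exact ⟨k, (hmem k p).2 ⟨i, hi⟩⟩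
  · rintro ⟨k, i⟩
    exact hgood k i

lemma combine {V κ : Type} [Fintype V] [DecidableEq V] [Fintype κ] {good : Finset V → Finset V → Prop}
    (μ : V × V → ℝ)
    (R : κ → Finset (V × V)) (T : Finset (V × V)) (c : κ → ℝ)
    (hd : ∀ k l, k ≠ l → Disjoint (R k) (R l))
    (hT : ∀ p, p ∈ T ↔ ∃ k, p ∈ R k)
    (h : ∀ k, ∃ E ⊆ R k, Tiled good (R k \ E) ∧ prSet μ E ≤ c k) :
    ∃ E ⊆ T, Tiled good (T \ E) ∧ prSet μ E ≤ ∑ k, c k := by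
  choose E hE ht hc using h
  refine ⟨Finset.univ.biUnion E, ?_, ?_, ?_⟩
  · intro p hp
    simp only [Finset.mem_biUnion, Finset.mem_univ, true_and] at hp
    obtain ⟨k, hk⟩ := hp
    exact (hT p).2 ⟨k, hE k hk⟩
  · refine Tiled.sigma (fun k => R k \ E k) _ ?_ ?_ ht
    · intro k l hkl
      exact Finset.disjoint_of_subset_left Finset.sdiff_subset
        (Finset.disjoint_of_subset_right Finset.sdiff_subset (hd k l hkl))
    · intro p
      simp only [Finset.mem_sdiff, hT, Finset.mem_biUnion, Finset.mem_univ, true_and]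
      constructor
      · rintro ⟨⟨k, hk⟩, hn⟩
        exact ⟨k, hk, fun h => hn ⟨k, h⟩⟩
      · rintro ⟨k, hk, hn⟩
        refine ⟨⟨k, hk⟩, ?_⟩
        rintro ⟨l, hl⟩
        by_cases hkl : k = l
        · subst hkl; exact hn hl
        · exact Finset.disjoint_left.1 (hd k l hkl) hk (hE l hl)
  · rw [prSet_partition μ (Finset.univ.biUnion E) E ?_ (by simp)]
    · exact Finset.sum_le_sum fun k _ => hc k
    · intro k l hkl
      exact Finset.disjoint_of_subset_left (hE k)
        (Finset.disjoint_of_subset_right (hE l) (hd k l hkl))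

/-- The potential constant. -/
def Kc (C Q w : ℝ) (d k : ℕ) : ℝ := C * Q ^ (-(0.95 : ℝ) * k) * w ^ (d - k)

lemma Kc_step {C Q w : ℝ} (hC : 0 ≤ C) (hQ : 1 ≤ Q) (hw : w = 2 * Q ^ (-(0.05 : ℝ)))
    (hw1 : w ≤ 1) (d i k : ℕ) (hk : 1 ≤ k) :
    2 * (Kc C Q w d (i + k) * (Q ^ ((0.5 : ℝ) * k) * Q ^ ((0.4 : ℝ) * k))) ≤ Kc C Q w d i := by
  have hQ0 : 0 < Q := by linarith
  have hw0 : 0 ≤ w := by rw [hw]; positivity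
  have e1 : Q ^ (-(0.95 : ℝ) * ((i + k : ℕ) : ℝ)) * (Q ^ ((0.5 : ℝ) * k) * Q ^ ((0.4 : ℝ) * k))
      = Q ^ (-(0.95 : ℝ) * i) * (Q ^ (-(0.05 : ℝ))) ^ k := by
    rw [← Real.rpow_natCast (Q ^ (-(0.05 : ℝ))) k, ← Real.rpow_mul hQ0.le, ← Real.rpow_add hQ0,
      ← Real.rpow_add hQ0, ← Real.rpow_add hQ0]
    congr 1
    push_cast
    ring
  have e2 : 2 * (Q ^ (-(0.05 : ℝ))) ^ k ≤ w ^ k := by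
    rw [hw, mul_pow]
    apply mul_le_mul_of_nonneg_right _ (by positivity)
    calc (2 : ℝ) = 2 ^ 1 := by norm_num
      _ ≤ 2 ^ k := pow_le_pow_right₀ (by norm_num) hk
  have e3 : 2 * (Q ^ (-(0.05 : ℝ))) ^ k * w ^ (d - (i + k)) ≤ w ^ (d - i) := by
    calc _ ≤ w ^ k * w ^ (d - (i + k)) := mul_le_mul_of_nonneg_right e2 (by positivity)
      _ = w ^ (k + (d - (i + k))) := by rw [pow_add]
      _ ≤ _ := pow_le_pow_of_le_one hw0 hw1 (by omega)
  unfold Kc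
  calc _ = C * (Q ^ (-(0.95 : ℝ) * ((i + k : ℕ) : ℝ)) *
        (Q ^ ((0.5 : ℝ) * k) * Q ^ ((0.4 : ℝ) * k))) * 2 * w ^ (d - (i + k)) := by ring
    _ = C * Q ^ (-(0.95 : ℝ) * i) * (2 * (Q ^ (-(0.05 : ℝ))) ^ k * w ^ (d - (i + k))) := by
        rw [e1]; ring
    _ ≤ _ := mul_le_mul_of_nonneg_left e3 (by positivity)

lemma step_ineq {κ : Type} [Fintype κ] {Q K K' m1 m2 mR : ℝ} (k : ℕ) (hQ : 1 ≤ Q)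
    (hcard : (Fintype.card κ : ℝ) = Q ^ k)
    (hK' : 0 ≤ K') (hK : 2 * (K' * (Q ^ ((0.5 : ℝ) * k) * Q ^ ((0.4 : ℝ) * k))) ≤ K)
    (f : κ → ℝ) (hf : ∀ b, 0 ≤ f b) (hsum : ∑ b, f b = m1) (h2 : 0 ≤ m2)
    (hR : m1 + m2 = mR) (hpos : 0 < mR) (hv : Q ^ (-(0.8 : ℝ) * k) * mR ≤ m1) :
    K * √m2 + ∑ b, K' * √(f b) ≤ K * √mR := by
  have hQ0 : 0 < Q := by linarith
  have hm1 : 0 ≤ m1 := by rw [← hsum]; exact Finset.sum_nonneg fun b _ => hf b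
  have c1 : ∑ b, √(f b) ≤ Q ^ ((0.5 : ℝ) * k) * √m1 := by
    have h1 := sq_sum_le_card_mul_sum_sq (s := (Finset.univ : Finset κ)) (f := fun b => √(f b))
    simp only [Real.sq_sqrt (hf _), hsum, Finset.card_univ, hcard] at h1
    have h3 : (Q ^ ((0.5 : ℝ) * k) * √m1) ^ 2 = Q ^ k * m1 := by
      rw [mul_pow, Real.sq_sqrt hm1, ← Real.rpow_natCast (Q ^ ((0.5 : ℝ) * k)) 2,
        ← Real.rpow_mul hQ0.le, ← Real.rpow_natCast Q k]
      congr 2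
      push_cast; ring
    rw [← h3] at h1
    exact le_of_sq_le_sq h1 (by positivity)
  have c2 : √mR ≤ Q ^ ((0.4 : ℝ) * k) * √m1 := by
    apply Real.sqrt_le_iff.2 ⟨by positivity, ?_⟩
    rw [mul_pow, Real.sq_sqrt hm1, ← Real.rpow_natCast (Q ^ ((0.4 : ℝ) * k)) 2,
        ← Real.rpow_mul hQ0.le]
    have : Q ^ ((0.4 : ℝ) * k * (2 : ℕ)) * (Q ^ (-(0.8 : ℝ) * k)) = 1 := by
      rw [← Real.rpow_add hQ0]
      have : (0.4 : ℝ) * k * (2 : ℕ) + (-(0.8 : ℝ) * k) = 0 := by push_cast; ring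
      rw [this, Real.rpow_zero]
    calc mR = Q ^ ((0.4 : ℝ) * k * (2 : ℕ)) * (Q ^ (-(0.8 : ℝ) * k)) * mR := by rw [this, one_mul]
      _ = Q ^ ((0.4 : ℝ) * k * (2 : ℕ)) * (Q ^ (-(0.8 : ℝ) * k) * mR) := by ring
      _ ≤ _ := mul_le_mul_of_nonneg_left hv (by positivity)
  have hs : 0 < √mR := Real.sqrt_pos.2 hpos
  have hK0 : 0 ≤ K := le_trans (by positivity) hK
  rw [← Finset.mul_sum]
  set a := √m1
  set b := √m2
  set r := √mR
  have ha : a ^ 2 = m1 := Real.sq_sqrt hm1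
  have hb : b ^ 2 = m2 := Real.sq_sqrt h2
  have hr : r ^ 2 = mR := Real.sq_sqrt hpos.le
  set P := Q ^ ((0.5 : ℝ) * k)
  set S := Q ^ ((0.4 : ℝ) * k)
  have hP : 0 ≤ P := by positivity
  have hS : 0 ≤ S := by positivity
  have ha0 : 0 ≤ a := Real.sqrt_nonneg _
  refine le_of_mul_le_mul_right ?_ hs
  have d1 : K' * (∑ b, √(f b)) * r ≤ K' * (P * a) * (S * a) := by
    apply mul_le_mul (mul_le_mul_of_nonneg_left c1 hK') c2 hs.le (by positivity)
  have d2 : K' * (P * a) * (S * a) ≤ K / 2 * m1 := by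
    rw [← ha]
    have := mul_le_mul_of_nonneg_right hK (sq_nonneg a)
    nlinarith
  have d3 : b * r ≤ (m2 + mR) / 2 := by nlinarith [sq_nonneg (b - r)]
  have d4 := mul_le_mul_of_nonneg_left d3 hK0
  have : K * r * r = K * mR := by rw [← hr]; ring
  nlinarith

open Classical in
lemma prMarg_fst {n q : ℕ} (μ : (Fin n → Fin q) × (Fin n → Fin q) → ℝ)
    (R : Finset ((Fin n → Fin q) × (Fin n → Fin q))) (J : Finset (Fin n)) (y : Fin n → Fin q) :
    prMarg (margFst (condDensity μ R)) J y =
      prSet μ (R.filter fun p => ∀ i ∈ J, p.1 i = y i) / prSet μ R := by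
  unfold prMarg margFst condDensity
  rw [← Finset.sum_div, div_div]
  have hc : (Fintype.card ((Fin n → Fin q) × (Fin n → Fin q)) : ℝ)
      = (Fintype.card (Fin n → Fin q) : ℝ) * (Fintype.card (Fin n → Fin q) : ℝ) := by
    rw [Fintype.card_prod]; push_cast; ring
  rw [← hc]
  conv_rhs => rw [prSet, div_right_comm]
  congr 1
  have e : ∀ g : (Fin n → Fin q) × (Fin n → Fin q) → ℝ,
      ∑ p ∈ R, g p = ∑ p, if p ∈ R then g p else 0 := fun g => by simp [Finset.sum_ite_mem]
  rw [Finset.sum_filter, Finset.sum_div, Finset.sum_filter, e, Fintype.sum_prod_type]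
  refine Finset.sum_congr rfl fun x _ => ?_
  by_cases hx : ∀ i ∈ J, x i = y i
  · simp only [if_pos hx]
    exact Finset.sum_congr rfl fun z _ => by split_ifs <;> rfl
  · simp [hx]

open Classical in
lemma prMarg_snd {n q : ℕ} (μ : (Fin n → Fin q) × (Fin n → Fin q) → ℝ)
    (R : Finset ((Fin n → Fin q) × (Fin n → Fin q))) (J : Finset (Fin n)) (y : Fin n → Fin q) :
    prMarg (margSnd (condDensity μ R)) J y =
      prSet μ (R.filter fun p => ∀ i ∈ J, p.2 i = y i) / prSet μ R := by
  unfold prMarg margSnd condDensity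
  rw [← Finset.sum_div, div_div]
  have hc : (Fintype.card ((Fin n → Fin q) × (Fin n → Fin q)) : ℝ)
      = (Fintype.card (Fin n → Fin q) : ℝ) * (Fintype.card (Fin n → Fin q) : ℝ) := by
    rw [Fintype.card_prod]; push_cast; ring
  rw [← hc]
  conv_rhs => rw [prSet, div_right_comm]
  congr 1
  have e : ∀ g : (Fin n → Fin q) × (Fin n → Fin q) → ℝ,
      ∑ p ∈ R, g p = ∑ p, if p ∈ R then g p else 0 := fun g => by simp [Finset.sum_ite_mem]
  rw [Finset.sum_filter, Finset.sum_div, Finset.sum_filter, e, Fintype.sum_prod_type_right]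
  refine Finset.sum_congr rfl fun x _ => ?_
  by_cases hx : ∀ i ∈ J, x i = y i
  · simp only [if_pos hx]
    exact Finset.sum_congr rfl fun z _ => by split_ifs <;> rfl
  · simp [hx]

lemma cbd_of {n q : ℕ} (hq : 1 ≤ q) {u : (Fin n → Fin q) → ℝ} {I : Finset (Fin n)} {d : ℕ}
    (hI : I.card ≤ d) (y0 : Fin n → Fin q) (h1 : prMarg u I y0 = 1)
    (hle : ∀ y, prMarg u I y ≤ 1) (hpos : ∀ J, ∃ y, 0 < prMarg u J y)
    (hJ : ∀ J : Finset (Fin n), Disjoint J I → ∀ y,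
      prMarg u J y ≤ (q : ℝ) ^ (-(0.8 : ℝ) * J.card)) :
    IsCBDWith (d : ℝ) I u := by
  have : Nonempty (Fin n → Fin q) := ⟨y0⟩
  have hq0 : (0 : ℝ) < q := by exact_mod_cast hq
  refine ⟨by exact_mod_cast hI, ?_, ?_⟩
  · have : (⨆ y : Fin n → Fin q, prMarg u I y) = 1 := by
      apply le_antisymm (ciSup_le hle)
      rw [← h1]
      exact le_ciSup (Set.finite_range _).bddAbove y0
    simp [projMinEntropy, this]
  · intro J hd
    unfold projMinEntropy
    obtain ⟨y, hy⟩ := hpos J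
    have hs : 0 < ⨆ y : Fin n → Fin q, prMarg u J y :=
      hy.trans_le (le_ciSup (Set.finite_range (fun y => prMarg u J y)).bddAbove y)
    have := Real.logb_le_logb_of_le (b := 2) (by norm_num) hs (ciSup_le (hJ J hd))
    rw [Real.logb_rpow_eq_mul_logb_of_pos hq0] at this
    rw [Fintype.card_fin]
    linarith

/-- The goodness predicate of the final statement. -/
def GoodR {n q : ℕ} (μ : (Fin n → Fin q) × (Fin n → Fin q) → ℝ) (d : ℕ)
    (A B : Finset (Fin n → Fin q)) : Prop :=
  0 < prSet μ (A ×ˢ B) ∧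
        ∃ I : Finset (Fin n),
          IsCBDWith (d : ℝ) I (margFst (condDensity μ (A ×ˢ B))) ∧
          IsCBDWith (d : ℝ) I (margSnd (condDensity μ (A ×ˢ B)))

lemma exists_pos_of_prSet {Ω : Type*} [Fintype Ω] {μ : Ω → ℝ} {S : Finset Ω}
    (h : 0 < prSet μ S) : ∃ x ∈ S, 0 < μ x := by
  by_contra hc
  push Not at hc
  have : prSet μ S ≤ 0 :=
    div_nonpos_of_nonpos_of_nonneg (Finset.sum_nonpos hc) (Nat.cast_nonneg _)
  linarith

lemma prSet_pos_of_mem {Ω : Type*} [Fintype Ω] {μ : Ω → ℝ} (hμ : ∀ x, 0 ≤ μ x) {S : Finset Ω}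
    {x : Ω} (hx : x ∈ S) (h : 0 < μ x) : 0 < prSet μ S := by
  have : 0 < Fintype.card Ω := Fintype.card_pos_iff.2 ⟨x⟩
  exact div_pos (Finset.sum_pos' (fun y _ => hμ y) ⟨x, hx, h⟩) (by exact_mod_cast this)

open Classical in
lemma good_of {n q : ℕ} (hq : 1 ≤ q) {μ : (Fin n → Fin q) × (Fin n → Fin q) → ℝ}
    (hμ : ∀ x, 0 ≤ μ x) {d : ℕ} {A B : Finset (Fin n → Fin q)} {I : Finset (Fin n)}
    (a b : Fin n → Fin q) (hA : ∀ x ∈ A, ∀ i ∈ I, x i = a i) (hB : ∀ x ∈ B, ∀ i ∈ I, x i = b i)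
    (hI : I.card ≤ d) (hpos : 0 < prSet μ (A ×ˢ B))
    (h1 : ∀ J : Finset (Fin n), Disjoint J I → ∀ y : Fin n → Fin q,
      prSet μ ((A ×ˢ B).filter fun p => ∀ i ∈ J, p.1 i = y i) ≤
        (q : ℝ) ^ (-(0.8 : ℝ) * J.card) * prSet μ (A ×ˢ B))
    (h2 : ∀ J : Finset (Fin n), Disjoint J I → ∀ y : Fin n → Fin q,
      prSet μ ((A ×ˢ B).filter fun p => ∀ i ∈ J, p.2 i = y i) ≤
        (q : ℝ) ^ (-(0.8 : ℝ) * J.card) * prSet μ (A ×ˢ B)) :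
    GoodR μ d A B := by
  obtain ⟨z, hz, hz0⟩ := exists_pos_of_prSet hpos
  refine ⟨hpos, I, ?_, ?_⟩
  · apply cbd_of hq hI a
    · rw [prMarg_fst, Finset.filter_true_of_mem, div_self hpos.ne']
      intro p hp
      exact hA _ (Finset.mem_product.1 hp).1
    · intro y
      rw [prMarg_fst, div_le_one hpos]
      exact prSet_mono' hμ (Finset.filter_subset _ _)
    · intro J
      refine ⟨z.1, ?_⟩
      rw [prMarg_fst]
      refine div_pos (prSet_pos_of_mem hμ (x := z) ?_ hz0) hpos
      simp only [Finset.mem_filter, hz, true_and, implies_true]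
    · intro J hJ y
      rw [prMarg_fst, div_le_iff₀ hpos]
      exact h1 J hJ y
  · apply cbd_of hq hI b
    · rw [prMarg_snd, Finset.filter_true_of_mem, div_self hpos.ne']
      intro p hp
      exact hB _ (Finset.mem_product.1 hp).2
    · intro y
      rw [prMarg_snd, div_le_one hpos]
      exact prSet_mono' hμ (Finset.filter_subset _ _)
    · intro J
      refine ⟨z.2, ?_⟩
      rw [prMarg_snd]
      refine div_pos (prSet_pos_of_mem hμ (x := z) ?_ hz0) hpos
      simp only [Finset.mem_filter, hz, true_and, implies_true]
    · intro J hJ y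
      rw [prMarg_snd, div_le_iff₀ hpos]
      exact h2 J hJ y

/-- One step of the decomposition, abstracted. -/
lemma step {V κ : Type} [Fintype V] [DecidableEq V] [Fintype κ] {good : Finset V → Finset V → Prop}
    {μ : V × V → ℝ} (hμ : ∀ x, 0 ≤ μ x) {C Q w : ℝ} (hC : 0 ≤ C) (hQ : 1 ≤ Q)
    (hw : w = 2 * Q ^ (-(0.05 : ℝ))) (hw1 : w ≤ 1) (d i k : ℕ) (hk : 1 ≤ k)
    (hcard : (Fintype.card κ : ℝ) = Q ^ k)
    (R R1 : Finset (V × V)) (S : Option κ → Finset (V × V))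
    (hd : ∀ k l, k ≠ l → Disjoint (S k) (S l))
    (hR : ∀ p, p ∈ R ↔ ∃ k, p ∈ S k)
    (hR1 : ∀ p, p ∈ R1 ↔ ∃ k, p ∈ S (some k))
    (hpos : 0 < prSet μ R) (hv : Q ^ (-(0.8 : ℝ) * k) * prSet μ R ≤ prSet μ R1)
    (h0 : ∃ E ⊆ S none, Tiled good (S none \ E) ∧ prSet μ E ≤ Kc C Q w d i * √(prSet μ (S none)))
    (h1 : ∀ b, ∃ E ⊆ S (some b), Tiled good (S (some b) \ E) ∧
      prSet μ E ≤ Kc C Q w d (i + k) * √(prSet μ (S (some b)))) :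
    ∃ E ⊆ R, Tiled good (R \ E) ∧ prSet μ E ≤ Kc C Q w d i * √(prSet μ R) := by
  have hc := combine (good := good) μ S R
    (fun o => o.elim (Kc C Q w d i * √(prSet μ (S none)))
      (fun b => Kc C Q w d (i + k) * √(prSet μ (S (some b))))) hd hR
    (by rintro (_ | b)
        · exact h0
        · exact h1 b)
  obtain ⟨E, hE, hT, hm⟩ := hc
  refine ⟨E, hE, hT, hm.trans ?_⟩
  rw [Fintype.sum_option]
  have hw0 : 0 ≤ w := by rw [hw]; positivity
  have s1 : prSet μ R1 = ∑ b, prSet μ (S (some b)) :=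
    prSet_partition μ R1 (fun b => S (some b))
      (fun k l h => hd _ _ (by simpa using h)) hR1
  have s2 : prSet μ R = prSet μ (S none) + prSet μ R1 := by
    rw [prSet_partition μ R S hd hR, Fintype.sum_option, s1]
  refine step_ineq (m1 := prSet μ R1) k hQ hcard ?_ (Kc_step hC hQ hw hw1 d i k hk) _
    (fun b => prSet_nonneg' hμ _) s1.symm (prSet_nonneg' hμ _) (by linarith) hpos hv
  unfold Kc
  positivity

open Classical in
lemma main_induction {n q : ℕ} (hq : 1 ≤ q) {μ : (Fin n → Fin q) × (Fin n → Fin q) → ℝ}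
    (hμ : ∀ x, 0 ≤ μ x) (d : ℕ) {C w : ℝ} (hC : 0 ≤ C)
    (hw : w = 2 * (q : ℝ) ^ (-(0.05 : ℝ))) (hw1 : w ≤ 1)
    (hH : ∀ (I : Finset (Fin n)) (a b : Fin n → Fin q),
      prSet μ (Finset.univ.filter fun p => (∀ i ∈ I, p.1 i = a i) ∧ (∀ i ∈ I, p.2 i = b i)) ≤
        C ^ 2 * (q : ℝ) ^ (-(1.9 : ℝ) * I.card)) (N : ℕ) :
    ∀ (A B : Finset (Fin n → Fin q)) (I : Finset (Fin n)) (a b : Fin n → Fin q),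
      (n - I.card) + A.card + B.card < N →
      (∀ x ∈ A, ∀ i ∈ I, x i = a i) → (∀ x ∈ B, ∀ i ∈ I, x i = b i) →
      ∃ E ⊆ A ×ˢ B, Tiled (GoodR μ d) ((A ×ˢ B) \ E) ∧
        prSet μ E ≤ Kc C q w d I.card * √(prSet μ (A ×ˢ B)) := by
  have hq0 : (0 : ℝ) < q := by exact_mod_cast hq
  have hq1 : (1 : ℝ) ≤ q := by exact_mod_cast hq
  have hw0 : 0 ≤ w := by rw [hw]; positivity
  induction N with
  | zero => intro A B I a b h; omega
  | succ N ih =>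
  intro A B I a b hN hA hB
  have hm0 := prSet_nonneg' hμ (A ×ˢ B)
  -- the case of zero mass
  rcases hm0.eq_or_lt with hz | hpos
  · refine ⟨A ×ˢ B, subset_rfl, by rw [Finset.sdiff_self]; exact Tiled.empty _, ?_⟩
    rw [← hz]; simp
  -- the case of too many fixed coordinates
  rcases lt_or_ge d I.card with hdI | hId
  · refine ⟨A ×ˢ B, subset_rfl, by rw [Finset.sdiff_self]; exact Tiled.empty _, ?_⟩
    have h1 : prSet μ (A ×ˢ B) ≤ C ^ 2 * (q : ℝ) ^ (-(1.9 : ℝ) * I.card) := by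
      refine le_trans (prSet_mono' hμ ?_) (hH I a b)
      intro p hp
      rw [Finset.mem_product] at hp
      simp only [Finset.mem_filter, Finset.mem_univ, true_and]
      exact ⟨hA _ hp.1, hB _ hp.2⟩
    have h2 : √(prSet μ (A ×ˢ B)) ≤ C * (q : ℝ) ^ (-(0.95 : ℝ) * I.card) := by
      apply Real.sqrt_le_iff.2 ⟨by positivity, h1.trans (le_of_eq ?_)⟩
      rw [mul_pow, ← Real.rpow_natCast ((q : ℝ) ^ (-(0.95 : ℝ) * I.card)) 2,
        ← Real.rpow_mul hq0.le]
      congr 2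
      push_cast; ring
    have h3 : d - I.card = 0 := by omega
    unfold Kc
    rw [h3, pow_zero, mul_one]
    calc prSet μ (A ×ˢ B) = √(prSet μ (A ×ˢ B)) * √(prSet μ (A ×ˢ B)) :=
          (Real.mul_self_sqrt hm0).symm
      _ ≤ _ := mul_le_mul_of_nonneg_right h2 (Real.sqrt_nonneg _)
  have hJpos : ∀ (J : Finset (Fin n)) (T : Finset ((Fin n → Fin q) × (Fin n → Fin q))),
      T ⊆ A ×ˢ B → (q : ℝ) ^ (-(0.8 : ℝ) * J.card) * prSet μ (A ×ˢ B) < prSet μ T →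
      1 ≤ J.card := by
    intro J T hT hlt
    by_contra hc
    have : J.card = 0 := by omega
    rw [this] at hlt
    simp only [Nat.cast_zero, mul_zero, Real.rpow_zero, one_mul] at hlt
    exact absurd (prSet_mono' hμ hT) (not_le.2 hlt)
  have hcardκ : ∀ J : Finset (Fin n), (Fintype.card (J → Fin q) : ℝ) = (q : ℝ) ^ J.card := by
    intro J; simp
  have hIn : ∀ J : Finset (Fin n), Disjoint J I → 1 ≤ J.card →
      (I ∪ J).card = I.card + J.card ∧ n - (I ∪ J).card < n - I.card := by
    intro J hJ h1
    have h2 := Finset.card_union_of_disjoint hJ.symm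
    have h3 := Finset.card_le_univ (I ∪ J)
    rw [Fintype.card_fin] at h3
    exact ⟨h2, by omega⟩
  by_cases hX : ∀ J : Finset (Fin n), Disjoint J I → ∀ y : Fin n → Fin q,
      prSet μ ((A ×ˢ B).filter fun p => ∀ i ∈ J, p.1 i = y i) ≤
        (q : ℝ) ^ (-(0.8 : ℝ) * J.card) * prSet μ (A ×ˢ B)
  swap
  · push Not at hX
    obtain ⟨J, hJI, y, hv⟩ := hX
    have hk := hJpos J _ (Finset.filter_subset _ _) hv
    obtain ⟨hu, hlt⟩ := hIn J hJI hk
    obtain ⟨z, hz, -⟩ := exists_pos_of_prSet (lt_of_le_of_lt (by positivity) hv)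
    rw [Finset.mem_filter, Finset.mem_product] at hz
    refine step (κ := J → Fin q) hμ hC hq1 hw hw1 d I.card J.card hk (hcardκ J) (A ×ˢ B)
      ((A ×ˢ B).filter fun p => ∀ i ∈ J, p.1 i = y i)
      (fun o => o.elim ((A.filter fun x => ¬ ∀ i ∈ J, x i = y i) ×ˢ B)
        (fun c => (A.filter fun x => ∀ i ∈ J, x i = y i) ×ˢ
          (B.filter fun x => ∀ i : J, x i = c i))) ?_ ?_ ?_ hpos hv.le ?_ ?_
    · rintro (_ | k) (_ | l) hkl
      · exact (hkl rfl).elim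
      · rw [Finset.disjoint_left]
        simp only [Option.elim, Finset.mem_product, Finset.mem_filter]
        tauto
      · rw [Finset.disjoint_left]
        simp only [Option.elim, Finset.mem_product, Finset.mem_filter]
        tauto
      · rw [Finset.disjoint_left]
        simp only [Option.elim, Finset.mem_product, Finset.mem_filter]
        rintro p ⟨-, -, h1⟩ ⟨-, -, h2⟩
        exact hkl (congrArg some (funext fun i => (h1 i).symm.trans (h2 i)))
    · intro p
      simp only [Option.exists, Option.elim, Finset.mem_product, Finset.mem_filter]
      constructor
      · rintro ⟨h1, h2⟩
        by_cases h : ∀ i ∈ J, p.1 i = y i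
        · exact Or.inr ⟨fun i => p.2 i, ⟨h1, h⟩, h2, fun i => rfl⟩
        · exact Or.inl ⟨⟨h1, h⟩, h2⟩
      · rintro (h | ⟨c, h⟩)
        · exact ⟨h.1.1, h.2⟩
        · exact ⟨h.1.1, h.2.1⟩
    · intro p
      simp only [Option.elim, Finset.mem_product, Finset.mem_filter]
      constructor
      · rintro ⟨⟨h1, h2⟩, h⟩
        exact ⟨fun i => p.2 i, ⟨h1, h⟩, h2, fun i => rfl⟩
      · rintro ⟨c, h⟩
        exact ⟨⟨h.1.1, h.2.1⟩, h.1.2⟩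
    · have hc : (A.filter fun x => ¬ ∀ i ∈ J, x i = y i).card < A.card := by
        apply Finset.card_lt_card
        rw [Finset.filter_ssubset]
        exact ⟨z.1, hz.1.1, not_not.2 hz.2⟩
      exact ih _ B I a b (by omega) (fun x hx => hA x (Finset.mem_filter.1 hx).1) hB
    · intro c
      rw [← hu]
      have hc1 := Finset.card_filter_le A (fun x => ∀ i ∈ J, x i = y i)
      have hc2 := Finset.card_filter_le B (fun x => ∀ i : J, x i = c i)
      refine ih _ _ (I ∪ J) (fun i => if i ∈ I then a i else y i)
        (fun i => if h : i ∈ J then c ⟨i, h⟩ else b i) (by omega) ?_ ?_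
      · intro x hx i hi
        rw [Finset.mem_filter] at hx
        by_cases h : i ∈ I
        · simp only [if_pos h]; exact hA x hx.1 i h
        · simp only [if_neg h]
          exact hx.2 i ((Finset.mem_union.1 hi).resolve_left h)
      · intro x hx i hi
        rw [Finset.mem_filter] at hx
        by_cases h : i ∈ J
        · simp only [dif_pos h]; exact hx.2 ⟨i, h⟩
        · simp only [dif_neg h]
          exact hB x hx.1 i ((Finset.mem_union.1 hi).resolve_right h)
  by_cases hY : ∀ J : Finset (Fin n), Disjoint J I → ∀ y : Fin n → Fin q,
      prSet μ ((A ×ˢ B).filter fun p => ∀ i ∈ J, p.2 i = y i) ≤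
        (q : ℝ) ^ (-(0.8 : ℝ) * J.card) * prSet μ (A ×ˢ B)
  swap
  · push Not at hY
    obtain ⟨J, hJI, y, hv⟩ := hY
    have hk := hJpos J _ (Finset.filter_subset _ _) hv
    obtain ⟨hu, hlt⟩ := hIn J hJI hk
    obtain ⟨z, hz, -⟩ := exists_pos_of_prSet (lt_of_le_of_lt (by positivity) hv)
    rw [Finset.mem_filter, Finset.mem_product] at hz
    refine step (κ := J → Fin q) hμ hC hq1 hw hw1 d I.card J.card hk (hcardκ J) (A ×ˢ B)
      ((A ×ˢ B).filter fun p => ∀ i ∈ J, p.2 i = y i)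
      (fun o => o.elim (A ×ˢ (B.filter fun x => ¬ ∀ i ∈ J, x i = y i))
        (fun c => (A.filter fun x => ∀ i : J, x i = c i) ×ˢ
          (B.filter fun x => ∀ i ∈ J, x i = y i))) ?_ ?_ ?_ hpos hv.le ?_ ?_
    · rintro (_ | k) (_ | l) hkl
      · exact (hkl rfl).elim
      · rw [Finset.disjoint_left]
        simp only [Option.elim, Finset.mem_product, Finset.mem_filter]
        tauto
      · rw [Finset.disjoint_left]
        simp only [Option.elim, Finset.mem_product, Finset.mem_filter]
        tauto
      · rw [Finset.disjoint_left]
        simp only [Option.elim, Finset.mem_product, Finset.mem_filter]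
        rintro p ⟨⟨-, h1⟩, -⟩ ⟨⟨-, h2⟩, -⟩
        exact hkl (congrArg some (funext fun i => (h1 i).symm.trans (h2 i)))
    · intro p
      simp only [Option.exists, Option.elim, Finset.mem_product, Finset.mem_filter]
      constructor
      · rintro ⟨h1, h2⟩
        by_cases h : ∀ i ∈ J, p.2 i = y i
        · exact Or.inr ⟨fun i => p.1 i, ⟨h1, fun i => rfl⟩, h2, h⟩
        · exact Or.inl ⟨h1, h2, h⟩
      · rintro (h | ⟨c, h⟩)
        · exact ⟨h.1, h.2.1⟩
        · exact ⟨h.1.1, h.2.1⟩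
    · intro p
      simp only [Option.elim, Finset.mem_product, Finset.mem_filter]
      constructor
      · rintro ⟨⟨h1, h2⟩, h⟩
        exact ⟨fun i => p.1 i, ⟨h1, fun i => rfl⟩, h2, h⟩
      · rintro ⟨c, h⟩
        exact ⟨⟨h.1.1, h.2.1⟩, h.2.2⟩
    · have hc : (B.filter fun x => ¬ ∀ i ∈ J, x i = y i).card < B.card := by
        apply Finset.card_lt_card
        rw [Finset.filter_ssubset]
        exact ⟨z.2, hz.1.2, not_not.2 hz.2⟩
      exact ih A _ I a b (by omega) hA (fun x hx => hB x (Finset.mem_filter.1 hx).1)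
    · intro c
      rw [← hu]
      have hc1 := Finset.card_filter_le B (fun x => ∀ i ∈ J, x i = y i)
      have hc2 := Finset.card_filter_le A (fun x => ∀ i : J, x i = c i)
      refine ih _ _ (I ∪ J) (fun i => if h : i ∈ J then c ⟨i, h⟩ else a i)
        (fun i => if i ∈ I then b i else y i) (by omega) ?_ ?_
      · intro x hx i hi
        rw [Finset.mem_filter] at hx
        by_cases h : i ∈ J
        · simp only [dif_pos h]; exact hx.2 ⟨i, h⟩
        · simp only [dif_neg h]
          exact hA x hx.1 i ((Finset.mem_union.1 hi).resolve_right h)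
      · intro x hx i hi
        rw [Finset.mem_filter] at hx
        by_cases h : i ∈ I
        · simp only [if_pos h]; exact hB x hx.1 i h
        · simp only [if_neg h]
          exact hx.2 i ((Finset.mem_union.1 hi).resolve_left h)
  -- the rectangle is good
  refine ⟨∅, Finset.empty_subset _, ?_, ?_⟩
  · rw [Finset.sdiff_empty]
    exact Tiled.single (good_of hq hμ a b hA hB hId hpos hX hY)
  · have : prSet μ ∅ = 0 := by simp [prSet]
    rw [this]
    unfold Kc
    positivity

/-- Converting a tiling of the complement of the error set to the indexed form. -/
lemma finish {n q : ℕ} {μ : (Fin n → Fin q) × (Fin n → Fin q) → ℝ} {d : ℕ} {ε : ℝ}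
    (h : ∃ E : Finset ((Fin n → Fin q) × (Fin n → Fin q)),
      Tiled (GoodR μ d) (Finset.univ \ E) ∧ prSet μ E ≤ ε) :
    ∃ (N : ℕ) (A B : Fin N → Finset (Fin n → Fin q))
      (Err : Finset ((Fin n → Fin q) × (Fin n → Fin q))),
      (∀ i j, i ≠ j → Disjoint (A i ×ˢ B i) (A j ×ˢ B j)) ∧
      (∀ i, Disjoint (A i ×ˢ B i) Err) ∧
      ((Finset.univ.biUnion fun i => A i ×ˢ B i) ∪ Err = Finset.univ) ∧
      (∀ i, 0 < prSet μ (A i ×ˢ B i) ∧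
        ∃ I : Finset (Fin n),
          IsCBDWith (d : ℝ) I (margFst (condDensity μ (A i ×ˢ B i))) ∧
          IsCBDWith (d : ℝ) I (margSnd (condDensity μ (A i ×ˢ B i)))) ∧
      prSet μ Err ≤ ε := by
  obtain ⟨E, ⟨ι, hι, A, B, hd, hmem, hg⟩, hE⟩ := h
  let e := Fintype.equivFin ι
  refine ⟨Fintype.card ι, fun i => A (e.symm i), fun i => B (e.symm i), E, ?_, ?_, ?_, ?_, hE⟩
  · intro i j hij
    exact hd _ _ (fun h => hij (e.symm.injective h))
  · intro i
    rw [Finset.disjoint_left]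
    intro p hp hpE
    have := (hmem p).2 ⟨_, hp⟩
    exact (Finset.mem_sdiff.1 this).2 hpE
  · ext p
    simp only [Finset.mem_union, Finset.mem_biUnion, Finset.mem_univ, true_and, iff_true]
    by_cases hp : p ∈ E
    · exact Or.inr hp
    · obtain ⟨i, hi⟩ := (hmem p).1 (Finset.mem_sdiff.2 ⟨Finset.mem_univ _, hp⟩)
      exact Or.inl ⟨e i, by simpa using hi⟩
  · intro i
    exact hg _

lemma prob_bound {n q : ℕ} (hq : 1 ≤ q)
    {μ : ((Fin n → Fin q) × (Fin n → Fin q)) → ℝ} {t : ℝ} {I : Finset (Fin n)}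
    (hent : 1.9 * Real.logb 2 (q : ℝ) * (I.card : ℝ) - t ≤ projMinEntropy2 μ I)
    (y : (Fin n → Fin q) × (Fin n → Fin q)) :
    prMarg2 μ I y ≤ (2 : ℝ) ^ t * (q : ℝ) ^ (-(1.9 : ℝ) * I.card) := by
  have hq0 : (0 : ℝ) < q := by exact_mod_cast hq
  rcases le_or_gt (prMarg2 μ I y) 0 with h | h
  · exact h.trans (by positivity)
  have hle : prMarg2 μ I y ≤ ⨆ y, prMarg2 μ I y :=
    le_ciSup (Set.finite_range (fun y => prMarg2 μ I y)).bddAbove y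
  refine hle.trans ?_
  have hs := h.trans_le hle
  unfold projMinEntropy2 at hent
  rw [← Real.logb_le_logb (b := 2) (by norm_num) hs (by positivity),
    Real.logb_mul (by positivity) (by positivity), Real.logb_rpow (by norm_num) (by norm_num),
    Real.logb_rpow_eq_mul_logb_of_pos hq0]
  linarith

/-- rectangular decomposition of a density with high min-entropy
projections into rectangles whose conditional marginals are aligned `d`-CBD. -/
theorem stmt14 (n q : ℕ) (hn : 1 ≤ n)
    (μ : ((Fin n → Fin q) × (Fin n → Fin q)) → ℝ) (hμ : IsDensity μ) (t : ℝ)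
    (hent : ∀ I : Finset (Fin n),
      1.9 * Real.logb 2 (q : ℝ) * (I.card : ℝ) - t ≤ projMinEntropy2 μ I)
    (d : ℕ) :
    ∃ (N : ℕ) (A B : Fin N → Finset (Fin n → Fin q))
      (Err : Finset ((Fin n → Fin q) × (Fin n → Fin q))),
      (∀ i j, i ≠ j → Disjoint (A i ×ˢ B i) (A j ×ˢ B j)) ∧
      (∀ i, Disjoint (A i ×ˢ B i) Err) ∧
      ((Finset.univ.biUnion fun i => A i ×ˢ B i) ∪ Err = Finset.univ) ∧
      (∀ i, 0 < prSet μ (A i ×ˢ B i) ∧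
        ∃ I : Finset (Fin n),
          IsCBDWith (d : ℝ) I (margFst (condDensity μ (A i ×ˢ B i))) ∧
          IsCBDWith (d : ℝ) I (margSnd (condDensity μ (A i ×ˢ B i)))) ∧
      prSet μ Err ≤ (2 : ℝ) ^ t * ((d : ℝ) * (q : ℝ) ^ (-(0.05 : ℝ))) ^ d := by
  classical
  have hnn := hμ.1
  have hcard : (Fintype.card ((Fin n → Fin q) × (Fin n → Fin q)) : ℝ) ≠ 0 := by
    intro h
    have := hμ.2
    rw [uexp, h, div_zero] at this
    exact zero_ne_one this
  have huniv : prSet μ Finset.univ = 1 := hμ.2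
  have hq : 1 ≤ q := by
    rcases Nat.eq_zero_or_pos q with h | h
    · subst h
      exfalso
      apply hcard
      have : IsEmpty (Fin n → Fin 0) := ⟨fun f => (f ⟨0, hn⟩).elim0⟩
      simp
    · exact h
  have hq0 : (0 : ℝ) < q := by exact_mod_cast hq
  have hq1 : (1 : ℝ) ≤ q := by exact_mod_cast hq
  have hH : ∀ (I : Finset (Fin n)) (a b : Fin n → Fin q),
      prSet μ (Finset.univ.filter fun p => (∀ i ∈ I, p.1 i = a i) ∧ (∀ i ∈ I, p.2 i = b i)) ≤
        (2 : ℝ) ^ t * (q : ℝ) ^ (-(1.9 : ℝ) * I.card) := by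
    intro I a b
    have h := prob_bound hq (hent I) (a, b)
    unfold prMarg2 at h
    unfold prSet
    convert h
  have hne : Nonempty (Fin n → Fin q) := ⟨fun _ => ⟨0, hq⟩⟩
  let y0 : Fin n → Fin q := fun _ => ⟨0, hq⟩
  have ht1 : 1 ≤ (2 : ℝ) ^ t := by
    have := hH ∅ y0 y0
    simpa [huniv] using this
  apply finish
  -- trivial case
  by_cases htriv : 1 ≤ (2 : ℝ) ^ t * ((d : ℝ) * (q : ℝ) ^ (-(0.05 : ℝ))) ^ d
  · refine ⟨Finset.univ, ?_, by rw [huniv]; exact htriv⟩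
    rw [Finset.sdiff_self]
    exact Tiled.empty _
  push Not at htriv
  have hprod : (Finset.univ : Finset ((Fin n → Fin q) × (Fin n → Fin q))) =
      Finset.univ ×ˢ Finset.univ := Finset.univ_product_univ.symm
  have hd0 : d ≠ 0 := by
    rintro rfl
    simp at htriv
    linarith
  by_cases hd1 : d = 1
  · subst hd1
    refine ⟨∅, ?_, ?_⟩
    · rw [Finset.sdiff_empty, hprod]
      apply Tiled.single
      have ht2 : (2 : ℝ) ^ t ≤ (q : ℝ) ^ (0.05 : ℝ) := by
        have e : (q : ℝ) ^ (-(0.05 : ℝ)) * (q : ℝ) ^ (0.05 : ℝ) = 1 := by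
          rw [← Real.rpow_add hq0]; norm_num
        have h3 : (0 : ℝ) < (q : ℝ) ^ (0.05 : ℝ) := by positivity
        simp only [Nat.cast_one, one_mul, pow_one] at htriv
        nlinarith
      -- the sum over the fibres
      have hbound : ∀ (J : Finset (Fin n)) (T : Finset ((Fin n → Fin q) × (Fin n → Fin q)))
          (S : (J → Fin q) → Finset ((Fin n → Fin q) × (Fin n → Fin q))),
          (∀ k l, k ≠ l → Disjoint (S k) (S l)) → (∀ p, p ∈ T ↔ ∃ k, p ∈ S k) →
          (∀ k, prSet μ (S k) ≤ (2 : ℝ) ^ t * (q : ℝ) ^ (-(1.9 : ℝ) * J.card)) →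
          prSet μ T ≤ (q : ℝ) ^ (-(0.8 : ℝ) * J.card) := by
        intro J T S hdis hT hS
        rcases Nat.eq_zero_or_pos J.card with h0 | h0
        · rw [h0]
          simp only [Nat.cast_zero, mul_zero, Real.rpow_zero]
          rw [← huniv]
          exact prSet_mono' hnn (Finset.subset_univ _)
        · rw [prSet_partition μ T S hdis hT]
          have hk : (1 : ℝ) ≤ J.card := by exact_mod_cast h0
          calc ∑ k, prSet μ (S k)
              ≤ ∑ k : J → Fin q, (2 : ℝ) ^ t * (q : ℝ) ^ (-(1.9 : ℝ) * J.card) :=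
                Finset.sum_le_sum fun k _ => hS k
            _ = (q : ℝ) ^ ((J.card : ℝ)) * ((2 : ℝ) ^ t * (q : ℝ) ^ (-(1.9 : ℝ) * J.card)) := by
                simp
            _ ≤ (q : ℝ) ^ ((J.card : ℝ)) *
                  ((q : ℝ) ^ (0.05 : ℝ) * (q : ℝ) ^ (-(1.9 : ℝ) * J.card)) := by gcongr
            _ = (q : ℝ) ^ ((J.card : ℝ) + ((0.05 : ℝ) + (-(1.9 : ℝ) * J.card))) := by
                rw [Real.rpow_add hq0, Real.rpow_add hq0]
            _ ≤ _ := Real.rpow_le_rpow_of_exponent_le hq1 (by linarith)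
      have huniv2 : prSet μ ((Finset.univ : Finset (Fin n → Fin q)) ×ˢ
        (Finset.univ : Finset (Fin n → Fin q))) = 1 := by rw [← hprod, huniv]
      refine good_of (I := ∅) hq hnn y0 y0 (by simp) (by simp) (by simp)
        (by rw [huniv2]; exact one_pos) ?_ ?_
      · intro J _ y
        rw [huniv2, mul_one]
        refine hbound J _ (fun c => Finset.univ.filter fun p =>
          (∀ i ∈ J, p.1 i = y i) ∧ (∀ i ∈ J, p.2 i = if h : i ∈ J then c ⟨i, h⟩ else y0 i))
          ?_ ?_ (fun c => hH J y _)
        · intro k l hkl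
          rw [Finset.disjoint_left]
          intro p h1 h2
          simp only [Finset.mem_filter, Finset.mem_univ, true_and] at h1 h2
          apply hkl
          funext i
          have := (h1.2 i i.2).symm.trans (h2.2 i i.2)
          simpa using this
        · intro p
          simp only [Finset.mem_filter, Finset.mem_univ, true_and, Finset.mem_product]
          constructor
          · intro h
            refine ⟨fun i => p.2 i, h, fun i hi => by simp [hi]⟩
          · rintro ⟨c, h, -⟩
            exact h
      · intro J _ y
        rw [huniv2, mul_one]
        refine hbound J _ (fun c => Finset.univ.filter fun p =>
          (∀ i ∈ J, p.1 i = if h : i ∈ J then c ⟨i, h⟩ else y0 i) ∧ (∀ i ∈ J, p.2 i = y i))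
          ?_ ?_ (fun c => hH J _ y)
        · intro k l hkl
          rw [Finset.disjoint_left]
          intro p h1 h2
          simp only [Finset.mem_filter, Finset.mem_univ, true_and] at h1 h2
          apply hkl
          funext i
          have := (h1.1 i i.2).symm.trans (h2.1 i i.2)
          simpa using this
        · intro p
          simp only [Finset.mem_filter, Finset.mem_univ, true_and, Finset.mem_product]
          constructor
          · intro h
            refine ⟨fun i => p.1 i, fun i hi => by simp [hi], h⟩
          · rintro ⟨c, -, h⟩
            exact h
    · have : prSet μ ∅ = 0 := by simp [prSet]
      rw [this]
      positivity
  have hd2 : (2 : ℝ) ≤ d := by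
    have : 2 ≤ d := by omega
    exact_mod_cast this
  have hx0 : (0 : ℝ) < (q : ℝ) ^ (-(0.05 : ℝ)) := by positivity
  have hdw : (d : ℝ) * (q : ℝ) ^ (-(0.05 : ℝ)) < 1 := by
    by_contra hc
    push Not at hc
    have h1 := one_le_pow₀ hc (n := d)
    nlinarith
  have hwd : 2 * (q : ℝ) ^ (-(0.05 : ℝ)) ≤ (d : ℝ) * (q : ℝ) ^ (-(0.05 : ℝ)) :=
    mul_le_mul_of_nonneg_right hd2 hx0.le
  obtain ⟨E, -, hT, hE⟩ := main_induction (C := √((2 : ℝ) ^ t)) hq hnn d (Real.sqrt_nonneg _) rfl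
    (hwd.trans hdw.le)
    (fun I a b => by
      rw [Real.sq_sqrt (by positivity)]
      convert hH I a b) _ Finset.univ Finset.univ ∅ y0 y0 (Nat.lt_succ_self _) (by simp) (by simp)
  refine ⟨E, by rw [hprod]; exact hT, hE.trans ?_⟩
  rw [← hprod, huniv]
  have h2 : √((2 : ℝ) ^ t) ≤ (2 : ℝ) ^ t := by
    rw [Real.sqrt_le_iff]
    exact ⟨by positivity, by nlinarith⟩
  simp only [Kc, Finset.card_empty, Nat.cast_zero, mul_zero, Real.rpow_zero, mul_one,
    Nat.sub_zero, Real.sqrt_one]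
  gcongr
end
end
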